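/- Let f(x,y) = −80y² − 46xy + 89x² − 118y³ + 123xy² − 78x²y + 33x³ + 113y⁴ − 40xy³ + 94x²y² − 128x³y − 133x⁴ + 120y⁵ + 40xy⁴ − 104x²y³ + 25x³y² − 10x⁴y − 64x⁵ − 37y⁶ + 25xy⁵ + 40x²y⁴ − 82x³y³ − 56x⁴y² + 89x⁵y + 67x⁶. Then the hessian curve Z = {(x,y) ∈ ℝ² : Hess(f)(x,y) = 0} has exactly 14 connected components, of which exactly 10 are bounded subsets of ℝ² (ovals) and exactly 4 are unbounded. -/

import Mathlib

open MvPolynomial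

/-- The hessian determinant of a polynomial in two variables over the reals:
`Hess f = f_xx * f_yy - f_xy ^ 2` (with formal partial derivatives). -/
noncomputable def Hess (f : MvPolynomial (Fin 2) ℝ) : MvPolynomial (Fin 2) ℝ :=
  pderiv 0 (pderiv 0 f) * pderiv 1 (pderiv 1 f) - (pderiv 0 (pderiv 1 f)) ^ 2

/-- The set of connected components of a set `Z ⊆ ℝ × ℝ` (with its subspace
topology), viewed as subsets of `ℝ × ℝ`. -/
def components (Z : Set (ℝ × ℝ)) : Set (Set (ℝ × ℝ)) :=
  {C | ∃ p ∈ Z, C = connectedComponentIn Z p}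

/-- The polynomial `f` of the statement. -/
noncomputable def f : MvPolynomial (Fin 2) ℝ :=
  -80 * (X 1)^2 - 46 * (X 0)*(X 1) + 89 * (X 0)^2 - 118 * (X 1)^3 + 123 * (X 0)*(X 1)^2 - 78 * (X 0)^2*(X 1) + 33 * (X 0)^3 + 113 * (X 1)^4 - 40 * (X 0)*(X 1)^3 + 94 * (X 0)^2*(X 1)^2 - 128 * (X 0)^3*(X 1) - 133 * (X 0)^4 + 120 * (X 1)^5 + 40 * (X 0)*(X 1)^4 - 104 * (X 0)^2*(X 1)^3 + 25 * (X 0)^3*(X 1)^2 - 10 * (X 0)^4*(X 1) - 64 * (X 0)^5 - 37 * (X 1)^6 + 25 * (X 0)*(X 1)^5 + 40 * (X 0)^2*(X 1)^4 - 82 * (X 0)^3*(X 1)^3 - 56 * (X 0)^4*(X 1)^2 + 89 * (X 0)^5*(X 1) + 67 * (X 0)^6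

/-- The hessian curve of `f` in `ℝ²`. -/
noncomputable def Z : Set (ℝ × ℝ) := {p | eval ![p.1, p.2] (Hess f) = 0}

namespace HessCurve

noncomputable section

/-- Coefficients of `a + (c + X) * m`, where `m` lists the coefficients of a polynomial in `X`. -/
def consMulR (c : ℕ) (a : ℕ) (m : List ℕ) : List ℕ :=
  List.rec (motive := fun _ => ℕ → List ℕ) (fun a => [a])
    (fun b _ ih a => Nat.add a (Nat.mul c b) :: ih b) m a

/-- Taylor shift `X ↦ X + c` of a coefficient list. -/
def shiftR (c : ℕ) (l : List ℕ) : List ℕ :=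
  List.rec [] (fun a _ ih => consMulR c a ih) l

/-- Coefficients of `l + c * m`. -/
def addMulR (c : ℕ) (l : List ℕ) : List ℕ → List ℕ :=
  List.rec (motive := fun _ => List ℕ → List ℕ)
    (fun m => List.rec [] (fun b _ ih => Nat.mul c b :: ih) m)
    (fun a l ih m => List.rec (a :: l) (fun b m _ => Nat.add a (Nat.mul c b) :: ih m) m) l

/-- Taylor shift `X ↦ X + c` of the inner variable. -/
def shiftX (c : ℕ) (p : List (List ℕ)) : List (List ℕ) :=
  List.rec [] (fun a _ ih => shiftR c a :: ih) p

/-- Coefficients of `a + (c + Y) * m`. -/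
def consMulP (c : ℕ) (a : List ℕ) (m : List (List ℕ)) : List (List ℕ) :=
  List.rec (motive := fun _ => List ℕ → List (List ℕ)) (fun a => [a])
    (fun b _ ih a => addMulR c a b :: ih b) m a

/-- Taylor shift `Y ↦ Y + c` of the outer variable. -/
def shiftY (c : ℕ) (p : List (List ℕ)) : List (List ℕ) :=
  List.rec [] (fun a _ ih => consMulP c a ih) p

/-- Sum of two polynomials. -/
def addP (l : List (List ℕ)) : List (List ℕ) → List (List ℕ) :=
  List.rec (motive := fun _ => List (List ℕ) → List (List ℕ))
    (fun m => m)
    (fun a l ih m => List.rec (a :: l) (fun b m _ => addMulR 1 a b :: ih m) m) l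

/-- Derivative with respect to the outer variable. -/
def derivY (p : List (List ℕ)) : List (List ℕ) :=
  List.rec [] (fun _ t ih => addP t ([] :: ih)) p

/-- The packing base: `n` stands for the integer `n % base - n / base`. -/
def base : ℕ := 115792089237316195423570985008687907853269984665640564039457584007913129639936

/-- Absolute value of a packed integer. -/
def absN (n : ℕ) : ℕ :=
  Nat.add (Nat.sub (Nat.mod n base) (Nat.div n base)) (Nat.sub (Nat.div n base) (Nat.mod n base))

def absR (h : ℕ) (l : List ℕ) : ℕ :=
  List.rec 0 (fun a _ ih => Nat.add (absN a) (Nat.mul h ih)) l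

def absP (h k : ℕ) (p : List (List ℕ)) : ℕ :=
  List.rec 0 (fun a _ ih => Nat.add (absR h a) (Nat.mul k ih)) p

def headR (l : List ℕ) : ℕ := List.rec 0 (fun a _ _ => a) l

def headP (p : List (List ℕ)) : List ℕ := List.rec [] (fun a _ _ => a) p

/-- Value of a packed coefficient list. -/
def evalR (x : ℕ) (l : List ℕ) : ℕ :=
  List.rec 0 (fun a _ ih => Nat.add a (Nat.mul x ih)) l

def evalP (x y : ℕ) (p : List (List ℕ)) : ℕ :=
  List.rec 0 (fun a _ ih => Nat.add (evalR x a) (Nat.mul y ih)) p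

/-- The rectangle `[x₀, x₁] × [y₀, y₁]`. -/
structure Box where
  x₀ : ℕ
  x₁ : ℕ
  y₀ : ℕ
  y₁ : ℕ

/-- A candidate cut: its distance to the boundary, its direction and its offset. -/
structure Cut where
  score : ℕ
  dir : Bool
  offset : ℕ

/-- The boxes of `R` that overlap `[x, x + w] × [y, y + z]`. -/
def overlapping (x w y z : ℕ) (R : List Box) : List Box :=
  List.rec [] (fun r _ ih =>
    cond (and (Nat.ble (Nat.succ r.x₀) (Nat.add x w)) (and (Nat.ble (Nat.succ x) r.x₁)
      (and (Nat.ble (Nat.succ r.y₀) (Nat.add y z)) (Nat.ble (Nat.succ y) r.y₁)))) (r :: ih) ih) R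

/-- Whether some box of `R` contains `[x, x + w] × [y, y + z]`. -/
def contained (x w y z : ℕ) (R : List Box) : Bool :=
  List.rec false (fun r _ ih =>
    or (and (Nat.ble r.x₀ x) (and (Nat.ble (Nat.add x w) r.x₁)
      (and (Nat.ble r.y₀ y) (Nat.ble (Nat.add y z) r.y₁)))) ih) R

def improve (e x w : ℕ) (dir : Bool) (s : Cut) : Cut :=
  cond (and (Nat.ble (Nat.succ s.score) (Nat.sub e x))
    (Nat.ble (Nat.succ s.score) (Nat.sub (Nat.add x w) e)))
    ⟨cond (Nat.ble (Nat.sub e x) (Nat.sub (Nat.add x w) e)) (Nat.sub e x)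
      (Nat.sub (Nat.add x w) e), dir, Nat.sub e x⟩ s

/-- The most central cut of `[x, x + w] × [y, y + z]` along an edge of a box of `R`. -/
def bestCut (x w y z : ℕ) (R : List Box) : Cut :=
  List.rec ⟨0, true, 0⟩ (fun r _ ih =>
    improve r.x₀ x w true (improve r.x₁ x w true
      (improve r.y₀ y z false (improve r.y₁ y z false ih)))) R

/-- Checks that all zeros of `p` in the rectangle `[x, x + w] × [y, y + z]` lie in boxes of `R`;
here `p` is expanded at the corner `(x, y)`. -/
def cover (fuel : ℕ) : List (List ℕ) → ℕ → ℕ → ℕ → ℕ → List Box → Bool :=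
  Nat.rec (fun _ _ _ _ _ _ => false) (fun _ ih p x w y z R =>
    (fun R' => List.rec (motive := fun _ => Bool)
      ((fun c d => (fun pX => (fun q => (fun r => (fun q₀ a T =>
          cond (Nat.ble (Nat.succ T) (Nat.mul 2 q₀)) true
            (cond (Nat.ble (Nat.add T (Nat.mul 2 q₀)) (Nat.mul 3 a))
              (and (ih p x c y z R') (ih pX (Nat.add x c) (Nat.sub w c) y z R'))
              (and (ih p x w y d R') (ih (shiftY d p) x w (Nat.add y d) (Nat.sub z d) R'))))
          (absN (headR r)) (absR (Nat.sub w c) r) (absP (Nat.sub w c) (Nat.sub z d) q))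
          (headP q)) (shiftY d pX)) (shiftX c p)) (Nat.div w 2) (Nat.div z 2))
      (fun _ _ _ => or (contained x w y z R')
        (Cut.rec (fun s dir e => and (Nat.ble 1 s) (cond dir
          (and (Nat.ble e w)
            (and (ih p x e y z R') (ih (shiftX e p) (Nat.add x e) (Nat.sub w e) y z R')))
          (and (Nat.ble e z)
            (and (ih p x w y e R') (ih (shiftY e p) x w (Nat.add y e) (Nat.sub z e) R')))))
          (bestCut x w y z R'))) R') (overlapping x w y z R)) fuel

/-- Whether the packed integer `n` is negative. -/
def negN (n : ℕ) : Bool := Nat.ble (Nat.succ (Nat.mod n base)) (Nat.div n base)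

/-- Checks that `p` has exactly one zero on every vertical section of `[0, w] × [0, z]`, and that
this zero is transversal. -/
def graphCheck (p : List (List ℕ)) (w z : ℕ) : Bool :=
  and (cover 30 [headP p] 0 w 0 0 []) (and (cover 30 [headP (shiftY z p)] 0 w 0 0 [])
    (and (xor (negN (headR (headP p))) (negN (headR (headP (shiftY z p)))))
      (cover 30 (derivY p) 0 w 0 z [])))

end

section Soundness

variable {R : Type*} [CommSemiring R]

/-- Evaluation of a coefficient list. -/
def ev (x : R) : List ℕ → R
  | [] => 0
  | a :: l => a + x * ev x l

/-- Evaluation of a bivariate coefficient list. -/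
def ev₂ (x y : R) : List (List ℕ) → R
  | [] => 0
  | a :: l => ev x a + y * ev₂ x y l

theorem consMulR_nil (c a : ℕ) : consMulR c a [] = [a] := rfl

theorem consMulR_cons (c a b : ℕ) (m : List ℕ) :
    consMulR c a (b :: m) = (a + c * b) :: consMulR c b m := rfl

theorem shiftR_cons (c a : ℕ) (l : List ℕ) :
    shiftR c (a :: l) = consMulR c a (shiftR c l) := rfl

theorem addMulR_nil_nil (c : ℕ) : addMulR c [] [] = [] := rfl

theorem addMulR_nil_cons (c b : ℕ) (m : List ℕ) :
    addMulR c [] (b :: m) = (c * b) :: addMulR c [] m := rfl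

theorem addMulR_cons_nil (c a : ℕ) (l : List ℕ) : addMulR c (a :: l) [] = a :: l := rfl

theorem addMulR_cons_cons (c a b : ℕ) (l m : List ℕ) :
    addMulR c (a :: l) (b :: m) = (a + c * b) :: addMulR c l m := rfl

theorem shiftX_cons (c : ℕ) (a : List ℕ) (p : List (List ℕ)) :
    shiftX c (a :: p) = shiftR c a :: shiftX c p := rfl

theorem consMulP_nil (c : ℕ) (a : List ℕ) : consMulP c a [] = [a] := rfl

theorem consMulP_cons (c : ℕ) (a b : List ℕ) (m : List (List ℕ)) :
    consMulP c a (b :: m) = addMulR c a b :: consMulP c b m := rfl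

theorem shiftY_cons (c : ℕ) (a : List ℕ) (p : List (List ℕ)) :
    shiftY c (a :: p) = consMulP c a (shiftY c p) := rfl

theorem addP_nil (m : List (List ℕ)) : addP [] m = m := rfl

theorem addP_cons_nil (a : List ℕ) (l : List (List ℕ)) : addP (a :: l) [] = a :: l := rfl

theorem addP_cons_cons (a b : List ℕ) (l m : List (List ℕ)) :
    addP (a :: l) (b :: m) = addMulR 1 a b :: addP l m := rfl

theorem derivY_cons (a : List ℕ) (p : List (List ℕ)) :
    derivY (a :: p) = addP p ([] :: derivY p) := rfl

theorem ev_consMulR (c a : ℕ) (m : List ℕ) (x : R) :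
    ev x (consMulR c a m) = a + (x + c) * ev x m := by
  induction m generalizing a with
  | nil => simp [consMulR_nil, ev]
  | cons b m ih => simp only [consMulR_cons, ev, ih]; push_cast; ring

theorem ev_shiftR (c : ℕ) (l : List ℕ) (x : R) : ev x (shiftR c l) = ev (x + c) l := by
  induction l with
  | nil => rfl
  | cons a l ih => simp only [shiftR_cons, ev_consMulR, ih, ev]

theorem ev_addMulR (c : ℕ) (l m : List ℕ) (x : R) :
    ev x (addMulR c l m) = ev x l + c * ev x m := by
  induction l generalizing m with
  | nil =>
    induction m with
    | nil => simp [addMulR_nil_nil, ev]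
    | cons b m ih => simp only [addMulR_nil_cons, ev, ih]; push_cast; ring
  | cons a l ih =>
    cases m with
    | nil => simp [addMulR_cons_nil, ev]
    | cons b m => simp only [addMulR_cons_cons, ev, ih]; push_cast; ring

theorem ev₂_shiftX (c : ℕ) (p : List (List ℕ)) (x y : R) :
    ev₂ x y (shiftX c p) = ev₂ (x + c) y p := by
  induction p with
  | nil => rfl
  | cons a p ih => simp only [shiftX_cons, ev₂, ev_shiftR, ih]

theorem ev₂_consMulP (c : ℕ) (a : List ℕ) (m : List (List ℕ)) (x y : R) :
    ev₂ x y (consMulP c a m) = ev x a + (y + c) * ev₂ x y m := by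
  induction m generalizing a with
  | nil => simp [consMulP_nil, ev₂]
  | cons b m ih => simp only [consMulP_cons, ev₂, ih, ev_addMulR]; ring

theorem ev₂_shiftY (c : ℕ) (p : List (List ℕ)) (x y : R) :
    ev₂ x y (shiftY c p) = ev₂ x (y + c) p := by
  induction p with
  | nil => rfl
  | cons a p ih => simp only [shiftY_cons, ev₂_consMulP, ev₂, ih]

theorem ev₂_addP (l m : List (List ℕ)) (x y : R) :
    ev₂ x y (addP l m) = ev₂ x y l + ev₂ x y m := by
  induction l generalizing m with
  | nil => simp [addP_nil, ev₂]
  | cons a l ih =>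
    cases m with
    | nil => simp [addP_cons_nil, ev₂]
    | cons b m => simp only [addP_cons_cons, ev₂, ih, ev_addMulR]; push_cast; ring

theorem ev₂_derivY_cons (a : List ℕ) (p : List (List ℕ)) (x y : R) :
    ev₂ x y (derivY (a :: p)) = ev₂ x y p + y * ev₂ x y (derivY p) := by
  simp [derivY_cons, ev₂_addP, ev₂, ev]

theorem hasDerivAt_ev₂ (p : List (List ℕ)) (x y : ℝ) :
    HasDerivAt (fun y => ev₂ x y p) (ev₂ x y (derivY p)) y := by
  induction p with
  | nil => exact hasDerivAt_const y 0
  | cons a p ih =>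
    have h := ((hasDerivAt_id y).mul ih).const_add (ev x a)
    rw [ev₂_derivY_cons]
    simpa [ev₂] using h

theorem continuous_ev₂ (p : List (List ℕ)) : Continuous fun q : ℝ × ℝ => ev₂ q.1 q.2 p := by
  have h (l : List ℕ) : Continuous fun q : ℝ × ℝ => ev q.1 l := by
    induction l with
    | nil => exact continuous_const
    | cons a l ih => simp only [ev]; fun_prop
  induction p with
  | nil => exact continuous_const
  | cons a p ih => have := h a; simp only [ev₂]; fun_prop

theorem ev_mono {x x' : ℕ} (h : x ≤ x') (l : List ℕ) : ev x l ≤ ev x' l := by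
  induction l with
  | nil => rfl
  | cons a l ih => simp only [ev]; gcongr

theorem ev₂_mono {x x' y y' : ℕ} (hx : x ≤ x') (hy : y ≤ y') (p : List (List ℕ)) :
    ev₂ x y p ≤ ev₂ x' y' p := by
  induction p with
  | nil => rfl
  | cons a p ih => simp only [ev₂]; gcongr; exact ev_mono hx a

theorem ev₂_derivY_le (x y : ℕ) (p : List (List ℕ)) :
    ev₂ x y (derivY p) ≤ ev₂ x (y + 1) p := by
  induction p with
  | nil => rfl
  | cons a p ih =>
    rw [ev₂_derivY_cons, ev₂]
    have := ev₂_mono (le_refl x) (Nat.le_succ y) p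
    nlinarith [Nat.mul_le_mul_left y ih]

/-- `PackR l u v` says that `l` packs the difference of the coefficient lists `u` and `v`. -/
inductive PackR : List ℕ → List ℕ → List ℕ → Prop
  | nil : PackR [] [] []
  | cons (n a b : ℕ) (l u v : List ℕ) (hn : n = a + base * b) (h : PackR l u v) :
      PackR (n :: l) (a :: u) (b :: v)

/-- `PackP p u v` says that `p` packs the difference of the polynomials `u` and `v`. -/
inductive PackP : List (List ℕ) → List (List ℕ) → List (List ℕ) → Prop
  | nil : PackP [] [] []
  | cons (n a b : List ℕ) (l u v : List (List ℕ)) (hn : PackR n a b) (h : PackP l u v) :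
      PackP (n :: l) (a :: u) (b :: v)

theorem PackR.consMulR {m u v : List ℕ} (h : PackR m u v) (c : ℕ) {n a b : ℕ}
    (hn : n = a + base * b) : PackR (consMulR c n m) (consMulR c a u) (consMulR c b v) := by
  induction h generalizing n a b with
  | nil => exact .cons _ _ _ _ _ _ hn .nil
  | cons n' a' b' l u v hn' h ih =>
    exact .cons _ _ _ _ _ _ (by subst hn hn'; simp only [Nat.add_eq, Nat.mul_eq]; ring) (ih hn')

theorem PackR.shiftR {l u v : List ℕ} (h : PackR l u v) (c : ℕ) :
    PackR (shiftR c l) (shiftR c u) (shiftR c v) := by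
  induction h with
  | nil => exact .nil
  | cons n a b l u v hn h ih => exact ih.consMulR c hn

theorem PackR.addMulR {l u v m u' v' : List ℕ} (h : PackR l u v) (h' : PackR m u' v') (c : ℕ) :
    PackR (addMulR c l m) (addMulR c u u') (addMulR c v v') := by
  induction h generalizing m u' v' with
  | nil =>
    induction h' with
    | nil => exact .nil
    | cons n a b l u v hn h ih =>
      exact .cons _ _ _ _ _ _ (by subst hn; simp only [Nat.mul_eq]; ring) ih
  | cons n a b l u v hn h ih =>
    cases h' with
    | nil => exact .cons _ _ _ _ _ _ hn h
    | cons n' a' b' l' u' v' hn' h' =>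
      exact .cons _ _ _ _ _ _ (by subst hn hn'; simp only [Nat.add_eq, Nat.mul_eq]; ring) (ih h')

theorem PackP.shiftX {p u v : List (List ℕ)} (h : PackP p u v) (c : ℕ) :
    PackP (shiftX c p) (shiftX c u) (shiftX c v) := by
  induction h with
  | nil => exact .nil
  | cons n a b l u v hn h ih => exact .cons _ _ _ _ _ _ (hn.shiftR c) ih

theorem PackP.consMulP {m u v : List (List ℕ)} (h : PackP m u v) (c : ℕ) {n a b : List ℕ}
    (hn : PackR n a b) : PackP (consMulP c n m) (consMulP c a u) (consMulP c b v) := by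
  induction h generalizing n a b with
  | nil => exact .cons _ _ _ _ _ _ hn .nil
  | cons n' a' b' l u v hn' h ih => exact .cons _ _ _ _ _ _ (hn.addMulR hn' c) (ih hn')

theorem PackP.shiftY {p u v : List (List ℕ)} (h : PackP p u v) (c : ℕ) :
    PackP (shiftY c p) (shiftY c u) (shiftY c v) := by
  induction h with
  | nil => exact .nil
  | cons n a b l u v hn h ih => exact ih.consMulP c hn

theorem PackP.addP {p u v q u' v' : List (List ℕ)} (h : PackP p u v) (h' : PackP q u' v') :
    PackP (addP p q) (addP u u') (addP v v') := by
  induction h generalizing q u' v' with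
  | nil => exact h'
  | cons n a b l u v hn h ih =>
    cases h' with
    | nil => exact .cons _ _ _ _ _ _ hn h
    | cons n' a' b' l' u' v' hn' h' => exact .cons _ _ _ _ _ _ (hn.addMulR hn' 1) (ih h')

theorem PackP.derivY {p u v : List (List ℕ)} (h : PackP p u v) :
    PackP (derivY p) (derivY u) (derivY v) := by
  induction h with
  | nil => exact .nil
  | cons n a b l u v hn h ih => exact h.addP (.cons _ _ _ _ _ _ .nil ih)

theorem PackP.headP {p u v : List (List ℕ)} (h : PackP p u v) :
    PackR (headP p) (headP u) (headP v) := by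
  cases h with
  | nil => exact .nil
  | cons n a b l u v hn h => exact hn

/-- The coefficients packed with positive sign. -/
def posPart (p : List (List ℕ)) : List (List ℕ) := p.map (List.map (· % base))

/-- The coefficients packed with negative sign. -/
def negPart (p : List (List ℕ)) : List (List ℕ) := p.map (List.map (· / base))

theorem packP_posPart_negPart (p : List (List ℕ)) : PackP p (posPart p) (negPart p) := by
  have h (l : List ℕ) : PackR l (l.map (· % base)) (l.map (· / base)) := by
    induction l with
    | nil => exact .nil
    | cons a l ih => exact .cons _ _ _ _ _ _ (Nat.mod_add_div a base).symm ih
  induction p with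
  | nil => exact .nil
  | cons a p ih => exact .cons _ _ _ _ _ _ (h a) ih

theorem absN_pack {a b : ℕ} (ha : a < base) : (absN (a + base * b) : ℝ) = |(a : ℝ) - b| := by
  have h₁ : (a + base * b) % base = a := by rw [Nat.add_mul_mod_self_left, Nat.mod_eq_of_lt ha]
  have h₂ : (a + base * b) / base = b := by
    rw [Nat.add_mul_div_left _ _ (by unfold base; norm_num), Nat.div_eq_of_lt ha, zero_add]
  have h : absN (a + base * b) = (a - b) + (b - a) := by
    change ((a + base * b) % base - (a + base * b) / base) +
      ((a + base * b) / base - (a + base * b) % base) = _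
    rw [h₁, h₂]
  rw [h]
  rcases le_total a b with h | h
  · rw [Nat.sub_eq_zero_of_le h, zero_add, Nat.cast_sub h, abs_of_nonpos]
    · ring
    · simpa using h
  · rw [Nat.sub_eq_zero_of_le h, add_zero, Nat.cast_sub h, abs_of_nonneg]
    simpa using h

theorem negN_pack {a b : ℕ} (ha : a < base) : negN (a + base * b) = true ↔ a < b := by
  have h₁ : (a + base * b) % base = a := by rw [Nat.add_mul_mod_self_left, Nat.mod_eq_of_lt ha]
  have h₂ : (a + base * b) / base = b := by
    rw [Nat.add_mul_div_left _ _ (by unfold base; norm_num), Nat.div_eq_of_lt ha, zero_add]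
  change Nat.ble (Nat.succ ((a + base * b) % base)) ((a + base * b) / base) = true ↔ _
  rw [h₁, h₂, Nat.ble_eq]
  rfl

end Soundness

section Cover

theorem PackR.abs_ev_sub_le {l u v : List ℕ} (h : PackR l u v) {X : ℕ} (hX : 1 ≤ X)
    (hu : ev X u < base) {x : ℝ} {k : ℕ} (hx : |x| ≤ k) : |ev x u - ev x v| ≤ absR k l := by
  induction h with
  | nil => simp [ev, absR]
  | cons n a b l u v hn h ih =>
    subst hn
    have ih := ih (lt_of_le_of_lt
      (le_trans (Nat.le_mul_of_pos_left _ hX) (Nat.le_add_left _ _)) hu)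
    have ha := absN_pack (b := b) (lt_of_le_of_lt (Nat.le_add_right a (X * ev X u)) hu)
    have hR : absR k ((a + base * b) :: l) = absN (a + base * b) + k * absR k l := rfl
    rw [hR]
    push_cast
    rw [ha]
    have hs : ev x (a :: u) - ev x (b :: v) = ((a : ℝ) - b) + x * (ev x u - ev x v) := by
      simp only [ev]; ring
    rw [hs]
    refine (abs_add_le _ _).trans ?_
    rw [abs_mul]
    gcongr

theorem PackP.abs_ev₂_sub_le {p u v : List (List ℕ)} (h : PackP p u v) {X Y : ℕ} (hX : 1 ≤ X)
    (hY : 1 ≤ Y) (hu : ev₂ X Y u < base) {x y : ℝ} {k m : ℕ} (hx : |x| ≤ k) (hy : |y| ≤ m) :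
    |ev₂ x y u - ev₂ x y v| ≤ absP k m p := by
  induction h with
  | nil => simp [ev₂, absP]
  | cons n a b l u v hn h ih =>
    have ih := ih (lt_of_le_of_lt
      (le_trans (Nat.le_mul_of_pos_left _ hY) (Nat.le_add_left _ _)) hu)
    have ha := hn.abs_ev_sub_le hX (lt_of_le_of_lt (Nat.le_add_right _ _) hu) hx
    have hR : absP k m (n :: l) = absR k n + m * absP k m l := rfl
    rw [hR]
    push_cast
    have hs : ev₂ x y (a :: u) - ev₂ x y (b :: v)
        = (ev x a - ev x b) + y * (ev₂ x y u - ev₂ x y v) := by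
      simp only [ev₂]; ring
    rw [hs]
    refine (abs_add_le _ _).trans ?_
    rw [abs_mul]
    gcongr

/-- A polynomial whose constant coefficient dominates has no zero. -/
theorem PackP.ev₂_ne {p u v : List (List ℕ)} (h : PackP p u v) {X Y : ℕ} (hX : 1 ≤ X)
    (hY : 1 ≤ Y) (hu : ev₂ X Y u < base) {x y : ℝ} {k m : ℕ} (hx : |x| ≤ k) (hy : |y| ≤ m)
    (hT : absP k m p < 2 * absN (headR (HessCurve.headP p))) : ev₂ x y u ≠ ev₂ x y v := by
  cases h with
  | nil => exact absurd hT (Nat.not_lt_zero _)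
  | cons n a b l u v hn h =>
    cases hn with
    | nil => 
      have h0 : absN (headR (HessCurve.headP ([] :: l))) = 0 := by
        change absN 0 = 0
        change (0 % base - 0 / base) + (0 / base - 0 % base) = 0
        simp
      rw [h0] at hT
      exact absurd hT (Nat.not_lt_zero _)
    | cons n a b r s t hn hr =>
      subst hn
      have hP : absP k m (((a + base * b) :: r) :: l)
        = (absN (a + base * b) + k * absR k r) + m * absP k m l := rfl
      have h0 : headR (HessCurve.headP (((a + base * b) :: r) :: l)) = a + base * b := rfl
      rw [hP, h0] at hT
      simp only [ev₂, ev, Nat.cast_id] at hu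
      have h1 := Nat.le_mul_of_pos_left (ev X s) hX
      have h2 := Nat.le_mul_of_pos_left (ev₂ X Y u) hY
      have ha := absN_pack (a := a) (b := b) (by omega)
      have h3 := hr.abs_ev_sub_le hX (by omega) hx
      have h4 := h.abs_ev₂_sub_le hX hY (by omega) hx hy
      intro he
      have hs : (a : ℝ) - b = -(x * (ev x s - ev x t) + y * (ev₂ x y u - ev₂ x y v)) := by
        simp only [ev₂, ev] at he; linarith
      have h5 : |(a : ℝ) - b| ≤ k * absR k r + m * absP k m l := by
        rw [hs, abs_neg]
        refine (abs_add_le _ _).trans ?_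
        rw [abs_mul, abs_mul]
        gcongr
      rw [← ha] at h5
      have h6 : absN (a + base * b) ≤ k * absR k r + m * absP k m l := by exact_mod_cast h5
      omega

/-- Membership of a point in a box. -/
def Box.Mem (r : Box) (x y : ℝ) : Prop := (r.x₀ ≤ x ∧ x ≤ r.x₁) ∧ (r.y₀ ≤ y ∧ y ≤ r.y₁)

/-- All zeros in `[x, x + w] × [y, y + z]` of the polynomial with expansion `p` at the corner
`(x, y)` lie in boxes of `R`. -/
def Covered (p : List (List ℕ)) (x w y z : ℕ) (R : List Box) : Prop :=
  ∀ u v, PackP p u v → ev₂ (w + 1) (z + 1) u < base → ∀ a b : ℝ, 0 ≤ a → a ≤ w → 0 ≤ b → b ≤ z →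
    ev₂ a b u = ev₂ a b v → ∃ r ∈ R, r.Mem (x + a) (y + b)

theorem Covered.mono {p : List (List ℕ)} {x w y z : ℕ} {R R' : List Box}
    (h : Covered p x w y z R') (hR : ∀ r ∈ R', r ∈ R) : Covered p x w y z R := by
  intro u v huv hu a b ha ha' hb hb' he
  obtain ⟨r, hr, hm⟩ := h u v huv hu a b ha ha' hb hb' he
  exact ⟨r, hR r hr, hm⟩

theorem Covered.splitX {p : List (List ℕ)} {x w y z e : ℕ} {R : List Box} (he : e ≤ w)
    (h₁ : Covered p x e y z R) (h₂ : Covered (shiftX e p) (x + e) (w - e) y z R) :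
    Covered p x w y z R := by
  intro u v huv hu a b ha ha' hb hb' h
  rcases le_total a e with hae | hae
  · exact h₁ u v huv (lt_of_le_of_lt (ev₂_mono (by omega) le_rfl u) hu) a b ha hae hb hb' h
  · obtain ⟨r, hr, hm⟩ := h₂ _ _ (huv.shiftX e)
      (by rw [ev₂_shiftX, Nat.cast_id, show w - e + 1 + e = w + 1 by omega]; exact hu)
      (a - e) b (by linarith) (by push_cast [he]; linarith) hb hb'
      (by rw [ev₂_shiftX, ev₂_shiftX, sub_add_cancel, h])
    refine ⟨r, hr, ?_⟩
    convert hm using 1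
    push_cast; ring

theorem Covered.splitY {p : List (List ℕ)} {x w y z e : ℕ} {R : List Box} (he : e ≤ z)
    (h₁ : Covered p x w y e R) (h₂ : Covered (shiftY e p) x w (y + e) (z - e) R) :
    Covered p x w y z R := by
  intro u v huv hu a b ha ha' hb hb' h
  rcases le_total b e with hae | hae
  · exact h₁ u v huv (lt_of_le_of_lt (ev₂_mono le_rfl (by omega) u) hu) a b ha ha' hb hae h
  · obtain ⟨r, hr, hm⟩ := h₂ _ _ (huv.shiftY e)
      (by rw [ev₂_shiftY, Nat.cast_id, show z - e + 1 + e = z + 1 by omega]; exact hu)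
      a (b - e) ha ha' (by linarith) (by push_cast [he]; linarith)
      (by rw [ev₂_shiftY, ev₂_shiftY, sub_add_cancel, h])
    refine ⟨r, hr, ?_⟩
    convert hm using 1
    push_cast; ring

theorem covered_of_dominated {p : List (List ℕ)} {x w y z c d : ℕ} {R : List Box}
    (hc : c ≤ w - c) (hc' : c ≤ w) (hd : d ≤ z - d) (hd' : d ≤ z)
    (h : absP (w - c) (z - d) (shiftY d (shiftX c p))
      < 2 * absN (headR (headP (shiftY d (shiftX c p))))) : Covered p x w y z R := by
  intro u v huv hu a b ha ha' hb hb' he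
  refine absurd ?_ (((huv.shiftX c).shiftY d).ev₂_ne (X := w - c + 1) (Y := z - d + 1)
    (x := a - c) (y := b - d) (by omega) (by omega) ?_ ?_ ?_ h)
  · simp only [ev₂_shiftX, ev₂_shiftY, sub_add_cancel]
    exact he
  · rw [ev₂_shiftY, ev₂_shiftX, Nat.cast_id, Nat.cast_id, show w - c + 1 + c = w + 1 by omega,
      show z - d + 1 + d = z + 1 by omega]
    exact hu
  · have : (c : ℝ) ≤ ((w - c : ℕ) : ℝ) := by exact_mod_cast hc
    push_cast [hc'] at this ⊢
    rw [abs_le]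
    constructor <;> linarith
  · have : (d : ℝ) ≤ ((z - d : ℕ) : ℝ) := by exact_mod_cast hd
    push_cast [hd'] at this ⊢
    rw [abs_le]
    constructor <;> linarith

theorem mem_of_mem_overlapping {x w y z : ℕ} {R : List Box} {r : Box}
    (h : r ∈ overlapping x w y z R) : r ∈ R := by
  induction R with
  | nil => exact h
  | cons s R ih =>
    change r ∈ cond _ (s :: overlapping x w y z R) (overlapping x w y z R) at h
    generalize (and (Nat.ble (Nat.succ s.x₀) _) _ : Bool) = b at h
    cases b with
    | false => exact List.mem_cons_of_mem _ (ih h)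
    | true =>
      rcases List.mem_cons.1 h with h | h
      · exact h ▸ List.mem_cons_self
      · exact List.mem_cons_of_mem _ (ih h)

theorem exists_of_contained {x w y z : ℕ} {R : List Box} (h : contained x w y z R = true) :
    ∃ r ∈ R, (r.x₀ ≤ x ∧ x + w ≤ r.x₁) ∧ (r.y₀ ≤ y ∧ y + z ≤ r.y₁) := by
  induction R with
  | nil => exact absurd h Bool.false_ne_true
  | cons s R ih =>
    change (_ || contained x w y z R) = true at h
    rw [Bool.or_eq_true] at h
    rcases h with h | h
    · simp only [Bool.and_eq_true, Nat.ble_eq] at h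
      exact ⟨s, List.mem_cons_self, ⟨h.1, h.2.1⟩, h.2.2⟩
    · obtain ⟨r, hr, h⟩ := ih h
      exact ⟨r, List.mem_cons_of_mem _ hr, h⟩

theorem covered_of_contained {p : List (List ℕ)} {x w y z : ℕ} {R : List Box}
    (h : contained x w y z R = true) : Covered p x w y z R := by
  intro u v _ _ a b ha ha' hb hb' _
  obtain ⟨r, hr, ⟨h₁, h₂⟩, h₃, h₄⟩ := exists_of_contained h
  have h₁ : (r.x₀ : ℝ) ≤ x := by exact_mod_cast h₁
  have h₂ : (x : ℝ) + w ≤ r.x₁ := by exact_mod_cast h₂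
  have h₃ : (r.y₀ : ℝ) ≤ y := by exact_mod_cast h₃
  have h₄ : (y : ℝ) + z ≤ r.y₁ := by exact_mod_cast h₄
  exact ⟨r, hr, ⟨by linarith, by linarith⟩, by linarith, by linarith⟩

theorem covered_of_cover {fuel : ℕ} {p : List (List ℕ)} {x w y z : ℕ} {R : List Box}
    (h : cover fuel p x w y z R = true) : Covered p x w y z R := by
  induction fuel generalizing p x w y z R with
  | zero => exact absurd h Bool.false_ne_true
  | succ n ih =>
    refine Covered.mono (R' := overlapping x w y z R) ?_ fun r => mem_of_mem_overlapping
    change List.rec (motive := fun _ => Bool) _ _ (overlapping x w y z R) = true at h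
    generalize overlapping x w y z R = R' at h ⊢
    cases R' with
    | nil =>
      change cond (Nat.ble (absP (w - w / 2) (z - z / 2) (shiftY (z / 2) (shiftX (w / 2) p)) + 1)
        (2 * absN (headR (headP (shiftY (z / 2) (shiftX (w / 2) p)))))) true
        (cond _ (cover n p x (w / 2) y z [] &&
          cover n (shiftX (w / 2) p) (x + w / 2) (w - w / 2) y z [])
          (cover n p x w y (z / 2) [] &&
            cover n (shiftY (z / 2) p) x w (y + z / 2) (z - z / 2) [])) = true at h
      cases h₁ : Nat.ble (absP (w - w / 2) (z - z / 2) (shiftY (z / 2) (shiftX (w / 2) p)) + 1)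
        (2 * absN (headR (headP (shiftY (z / 2) (shiftX (w / 2) p))))) with
      | true =>
        exact covered_of_dominated (by omega) (by omega) (by omega) (by omega) (Nat.le_of_ble_eq_true h₁)
      | false =>
        rw [h₁, cond_false] at h
        generalize Nat.ble (Nat.add _ _) _ = b at h
        cases b with
        | true =>
          rw [cond_true, Bool.and_eq_true] at h
          exact (ih h.1).splitX (by omega) (ih h.2)
        | false =>
          rw [cond_false, Bool.and_eq_true] at h
          exact (ih h.1).splitY (by omega) (ih h.2)
    | cons r R' =>
      change (contained x w y z (r :: R') ||
        Cut.rec (motive := fun _ => Bool) (fun s dir e => Nat.ble 1 s && (cond dir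
          (Nat.ble e w && (cover n p x e y z (r :: R') &&
            cover n (shiftX e p) (x + e) (w - e) y z (r :: R')))
          (Nat.ble e z && (cover n p x w y e (r :: R') &&
            cover n (shiftY e p) x w (y + e) (z - e) (r :: R')))))
          (bestCut x w y z (r :: R'))) = true at h
      rw [Bool.or_eq_true] at h
      rcases h with h | h
      · exact covered_of_contained h
      · generalize bestCut x w y z (r :: R') = cut at h
        obtain ⟨s, dir, e⟩ := cut
        replace h := (Bool.and_eq_true_iff.1 h).2
        cases dir with
        | true =>
          simp only [cond_true, Bool.and_eq_true, Nat.ble_eq] at h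
          exact (ih h.2.1).splitX h.1 (ih h.2.2)
        | false =>
          simp only [cond_false, Bool.and_eq_true, Nat.ble_eq] at h
          exact (ih h.2.1).splitY h.1 (ih h.2.2)

end Cover

section Graph

theorem mul_pos_of_forall_ne_zero {α : Type*} [TopologicalSpace α] {S : Set α} {F : α → ℝ}
    (hS : IsPreconnected S) (hF : ContinuousOn F S) (h : ∀ x ∈ S, F x ≠ 0) {x y : α}
    (hx : x ∈ S) (hy : y ∈ S) : 0 < F x * F y := by
  by_contra! hxy
  have h0 : (0 : ℝ) ∈ F '' S := by
    rcases mul_nonpos_iff.1 hxy with ⟨h₁, h₂⟩ | ⟨h₁, h₂⟩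
    · exact hS.intermediate_value hy hx hF ⟨h₂, h₁⟩
    · exact hS.intermediate_value hx hy hF ⟨h₁, h₂⟩
  obtain ⟨q, hq, hFq⟩ := h0
  exact h q hq hFq

/-- A function on a rectangle which is strictly monotone along vertical segments and has opposite
signs on the horizontal edges has a zero set which is the graph of a continuous function. -/
theorem exists_graph {F : ℝ × ℝ → ℝ} {F' : ℝ → ℝ → ℝ} (hF : Continuous F)
    (hF' : ∀ x y, HasDerivAt (fun y => F (x, y)) (F' x y) y) {w z : ℝ} (hw : 0 ≤ w) (hz : 0 ≤ z)
    (hne : ∀ a ∈ Set.Icc 0 w, ∀ b ∈ Set.Icc 0 z, F' a b ≠ 0)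
    (h₀ : ∀ a ∈ Set.Icc 0 w, F (a, 0) ≠ 0) (h₁ : ∀ a ∈ Set.Icc 0 w, F (a, z) ≠ 0)
    (hs : F (0, 0) * F (0, z) < 0) :
    ∃ g : ℝ → ℝ, ContinuousOn g (Set.Icc 0 w) ∧ ∀ a ∈ Set.Icc 0 w, g a ∈ Set.Icc 0 z ∧
      ∀ b ∈ Set.Icc 0 z, F (a, b) = 0 ↔ b = g a := by
  have hex : ∀ a ∈ Set.Icc 0 w, ∃ b ∈ Set.Icc 0 z, F (a, b) = 0 := by
    intro a ha
    by_contra! hcon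
    have e₀ := mul_pos_of_forall_ne_zero isPreconnected_Icc (F := fun a => F (a, 0))
      (by fun_prop) h₀ ha ⟨le_rfl, hw⟩
    have e₁ := mul_pos_of_forall_ne_zero isPreconnected_Icc (F := fun a => F (a, z))
      (by fun_prop) h₁ ha ⟨le_rfl, hw⟩
    have e₂ := mul_pos_of_forall_ne_zero isPreconnected_Icc (F := fun b => F (a, b))
      (by fun_prop) hcon ⟨le_rfl, hz⟩ ⟨hz, le_rfl⟩
    have e₃ := mul_pos (mul_pos e₀ e₁) e₂
    have : 0 ≤ (F (a, 0) * F (a, z)) ^ 2 := sq_nonneg _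
    nlinarith
  have hun : ∀ a ∈ Set.Icc 0 w, ∀ b ∈ Set.Icc 0 z, ∀ b' ∈ Set.Icc 0 z, F (a, b) = 0 →
      F (a, b') = 0 → ¬ b < b' := by
    intro a ha b hb b' hb' e e' hlt
    obtain ⟨c, hc, hc'⟩ := exists_hasDerivAt_eq_zero hlt
      (f := fun y => F (a, y)) (f' := F' a) (by fun_prop) (e.trans e'.symm) fun x _ => hF' a x
    exact hne a ha c ⟨hb.1.trans hc.1.le, hc.2.le.trans hb'.2⟩ hc'
  have huni : ∀ a ∈ Set.Icc 0 w, ∀ b ∈ Set.Icc 0 z, ∀ b' ∈ Set.Icc 0 z, F (a, b) = 0 →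
      F (a, b') = 0 → b = b' := fun a ha b hb b' hb' e e' =>
    le_antisymm (not_lt.1 (hun a ha b' hb' b hb e' e)) (not_lt.1 (hun a ha b hb b' hb' e e'))
  have hex' : ∀ a : Set.Icc 0 w, ∃ b : Set.Icc 0 z, F (a, b) = 0 := fun a => by
    obtain ⟨b, hb, h⟩ := hex a a.2
    exact ⟨⟨b, hb⟩, h⟩
  choose g hg using hex'
  have hgc : Continuous g := by
    rw [continuous_iff_isClosed]
    intro S hS
    have hcl : IsClosed {q : Set.Icc 0 w × Set.Icc 0 z | F (q.1, q.2) = 0 ∧ q.2 ∈ S} :=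
      (isClosed_eq (by fun_prop) continuous_const).inter (hS.preimage continuous_snd)
    convert isClosedMap_fst_of_compactSpace _ hcl using 1
    ext a
    constructor
    · exact fun ha => ⟨(a, g a), ⟨hg a, ha⟩, rfl⟩
    · rintro ⟨⟨a', b⟩, ⟨h, hb⟩, rfl⟩
      have : g a' = b := Subtype.ext (huni a' a'.2 _ (g a').2 _ b.2 (hg a') h)
      exact this ▸ hb
  refine ⟨fun a => g (Set.projIcc 0 w hw a), (by fun_prop), fun a ha => ⟨Subtype.coe_prop _, ?_⟩⟩
  intro b hb
  have : Set.projIcc 0 w hw a = ⟨a, ha⟩ := Set.projIcc_of_mem hw ha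
  simp only [this]
  constructor
  · intro h
    exact huni a ha b hb _ (g ⟨a, ha⟩).2 h (hg ⟨a, ha⟩)
  · rintro rfl
    exact hg ⟨a, ha⟩

/-- The real function encoded by a packed polynomial. -/
def val (p : List (List ℕ)) (q : ℝ × ℝ) : ℝ := ev₂ q.1 q.2 (posPart p) - ev₂ q.1 q.2 (negPart p)

theorem continuous_val (p : List (List ℕ)) : Continuous (val p) :=
  (continuous_ev₂ _).sub (continuous_ev₂ _)

theorem graph_of_graphCheck {p u v : List (List ℕ)} {w z : ℕ} (h : graphCheck p w z = true)
    (huv : PackP p u v) (hu : ev₂ (w + 1) (z + 2) u < base) :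
    ∃ g : ℝ → ℝ, ContinuousOn g (Set.Icc 0 w) ∧ ∀ a ∈ Set.Icc 0 (w : ℝ),
      g a ∈ Set.Icc 0 (z : ℝ) ∧ ∀ b ∈ Set.Icc 0 (z : ℝ), ev₂ a b u - ev₂ a b v = 0 ↔ b = g a := by
  simp only [graphCheck, Bool.and_eq_true] at h
  obtain ⟨hb, ht, hs, hd⟩ := h
  have edge {p u v : List (List ℕ)} (h : cover 30 [headP p] 0 w 0 0 [] = true)
      (huv : PackP p u v) (hu : ev₂ (w + 1) 1 u < base) :
      ∀ a ∈ Set.Icc 0 (w : ℝ), ev₂ a 0 u - ev₂ a 0 v ≠ 0 := by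
    intro a ha h0
    have e (x : ℝ) (u : List (List ℕ)) : ev₂ x 0 [headP u] = ev₂ x 0 u := by
      cases u <;> simp [ev₂, ev, headP]
    have e' (u : List (List ℕ)) : ev₂ (w + 1) 1 [headP u] ≤ ev₂ (w + 1) 1 u := by
      cases u <;> simp [ev₂, ev, headP]
    obtain ⟨r, hr, -⟩ := covered_of_cover h [headP u] [headP v] (.cons _ _ _ _ _ _ huv.headP .nil)
      (lt_of_le_of_lt (e' u) hu) a 0 ha.1 ha.2 le_rfl (by simp) (by rw [e, e]; linarith)
    exact absurd hr List.not_mem_nil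
  have huz : ev₂ (w + 1) 1 (shiftY z u) < base := by
    rw [ev₂_shiftY]
    exact lt_of_le_of_lt (ev₂_mono le_rfl (by simp; omega) u) hu
  have corner {p u v : List (List ℕ)} (huv : PackP p u v) (hu : ev₂ (w + 1) 1 u < base) :
      negN (headR (headP p)) = true ↔ ev₂ (0 : ℝ) 0 u - ev₂ 0 0 v < 0 := by
    have e0 : negN 0 = false := rfl
    cases huv with
    | nil => simp [ev₂, headP, headR, e0]
    | cons n a b L u v hn h =>
      cases hn with
      | nil => simp [ev₂, ev, headP, headR, e0]
      | cons n a b l u v hn h =>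
        subst hn
        have : a < base := by
          refine lt_of_le_of_lt ?_ hu
          simp only [ev₂, ev, Nat.cast_id]
          omega
        have e1 : headR (headP (((a + base * b) :: l) :: L)) = a + base * b := rfl
        rw [e1, negN_pack this]
        simp [ev₂, ev]
  have hus : ev₂ (w + 1) 1 u < base := lt_of_le_of_lt (ev₂_mono le_rfl (by omega) u) hu
  refine exists_graph (F := fun q => ev₂ q.1 q.2 u - ev₂ q.1 q.2 v)
    (F' := fun x y => ev₂ x y (derivY u) - ev₂ x y (derivY v))
    ((continuous_ev₂ _).sub (continuous_ev₂ _))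
    (fun x y => (hasDerivAt_ev₂ u x y).sub (hasDerivAt_ev₂ v x y)) (by positivity) (by positivity)
    ?_ (edge hb huv hus) ?_ ?_
  · intro a ha b hb h0
    obtain ⟨r, hr, -⟩ := covered_of_cover hd _ _ huv.derivY
      (lt_of_le_of_lt (ev₂_derivY_le _ _ u) hu) a b ha.1 ha.2 hb.1 hb.2 (by linarith)
    exact absurd hr List.not_mem_nil
  · have := edge ht (huv.shiftY z) huz
    simpa only [ev₂_shiftY, zero_add] using this
  · have c₁ := corner huv hus
    have c₂ := corner (huv.shiftY z) huz
    simp only [ev₂_shiftY, zero_add] at c₂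
    have n₁ := edge hb huv hus 0 (by simp)
    have n₂ := edge ht (huv.shiftY z) huz 0 (by simp)
    simp only [ev₂_shiftY, zero_add] at n₂
    simp only
    cases h₁ : negN (headR (headP p)) <;> cases h₂ : negN (headR (headP (shiftY z p))) <;>
      rw [h₁, h₂] at hs <;> simp only [h₁, h₂] at c₁ c₂
    · exact absurd hs (by decide)
    · have := c₂.1 trivial
      have := lt_of_le_of_ne (not_lt.1 fun h => by simpa using c₁.2 h) n₁.symm
      nlinarith
    · have := c₁.1 trivial
      have := lt_of_le_of_ne (not_lt.1 fun h => by simpa using c₂.2 h) n₂.symm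
      nlinarith
    · exact absurd hs (by decide)

theorem graph_of_graphCheck_shift {p : List (List ℕ)} {s w t z : ℕ}
    (h : graphCheck (shiftY t (shiftX s p)) w z = true)
    (hp : ev₂ (s + w + 1) (t + z + 2) (posPart p) < base) :
    ∃ g : ℝ → ℝ, ContinuousOn g (Set.Icc s (s + w)) ∧ ∀ a ∈ Set.Icc (s : ℝ) (s + w),
      g a ∈ Set.Icc (t : ℝ) (t + z) ∧ ∀ b ∈ Set.Icc (t : ℝ) (t + z), val p (a, b) = 0 ↔ b = g a := by
  obtain ⟨g, hg, hg'⟩ := graph_of_graphCheck h (((packP_posPart_negPart p).shiftX s).shiftY t) (by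
    rw [ev₂_shiftY, ev₂_shiftX, Nat.cast_id, Nat.cast_id]
    convert hp using 2 <;> ring)
  refine ⟨fun a => g (a - s) + t, ?_, fun a ha => ?_⟩
  · refine ContinuousOn.add (hg.comp (by fun_prop) fun a ha => ?_) continuousOn_const
    exact ⟨by linarith [ha.1], by linarith [ha.2]⟩
  · obtain ⟨h₁, h₂⟩ := hg' (a - s) ⟨by linarith [ha.1], by linarith [ha.2]⟩
    refine ⟨⟨by linarith [h₁.1], by linarith [h₁.2]⟩, fun b hb => ?_⟩
    have := h₂ (b - t) ⟨by linarith [hb.1], by linarith [hb.2]⟩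
    simp only [ev₂_shiftY, ev₂_shiftX, sub_add_cancel] at this
    rw [val, this]
    exact sub_eq_iff_eq_add

theorem covered_val {fuel : ℕ} {p : List (List ℕ)} {w z : ℕ} {R : List Box}
    (h : cover fuel p 0 w 0 z R = true) (hp : ev₂ (w + 1) (z + 1) (posPart p) < base) {q : ℝ × ℝ}
    (h₁ : q.1 ∈ Set.Icc 0 (w : ℝ)) (h₂ : q.2 ∈ Set.Icc 0 (z : ℝ)) (hq : val p q = 0) :
    ∃ r ∈ R, r.Mem q.1 q.2 := by
  have := covered_of_cover h _ _ (packP_posPart_negPart p) hp q.1 q.2 h₁.1 h₁.2 h₂.1 h₂.2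
    (sub_eq_zero.1 hq)
  simpa using this

end Graph

section Polynomials

def polyA : List (List ℕ) :=
  [[42484879782516118471535515298558769963517299408121267655790374321082377685250949588495195321735172719178185271335920461986922496, 5194985220734749096582706002325898048770670592, 3695620081928870365899981811538779002659793975706977606485702540645925519342777590092799333615352813436385401816219648, 138899708321874470223241771598479360, 57997409059014652782206514497670340888957664812462366078474990859090678250900888046065902667008962251980800, 1244014526662389035696128, 209779844198226213661608097921335354741051882772332841335225324639649017181202096172331813568512, 1377129594880, 48996843600324161512506944451501244768571927661342476470476279385028401241490718720],
  [3496903788436617961650044954953565916046032896, 5098886900433860368683402531477391458574823256161781543817896539571149642979389615194322766351801149818325941023145984, 155598878135576410502332356608655360, 11623313836177741389978690672805604480587839172382886192068981819780023147659757326924797105188742082068480, 12325574884186962424193159473062940234175283695761008466571730406546169562544457562398499694719270912, 59566454985827100091062380656936089507976207462164224379831094985934420346956802075234815442944, 1381807554560, 91424801978215375258634706923459624524627849092603163742994130029287890638507868160],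
  [1621296732075415601664239248545324341415553846329925521872888257460704304008102248067212203454261517476315723496161280, 230592207875002911015306295781621760, 111675886745886351376533315133456821779469943530844168335917329781412453045921987746220757826691572032339968, 721765794215580412149760, 1782819037416259584, 289573617991138354770920329499267845874458837676974713244194766604303029345099252110458880, 620420],
  [6052023492848818752877970325504000, 56848839852685239282394977049612761102190578808077848507204778085874124144761435335121064201353992924561408, 3010680616573443824943104, 494426658780328611063157537725178378195908820421837296425257654695837500000341384942737302749184, 390126632960, 1299080],
  [99645374065549952673258668032, 3539542321373623361053856815031845907400354881022673449189844087500780156768545584085410302979473408, 403103640469312258772142635342000999467018147861456052684610951036525825407477192473640209219584, 5802266460160, 208394496763075076389663408849685888400765589502293292318732997666561496806882017280],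
  [26897377915780207371916562213291481166749294412582693158149439319119775404967617437913183399461257216, 1409357835594104832, 710157926400, 231931554742344339433412682972401879430099779285278049771033540767849998668791808000],
  [118253764057497600, 186663541189113652238009648270079137662247091981822189651281813458508025596453042572492800, 620420],
  [120444682240, 506120],
  [12091588918606743707106400109532234777577718148709515899820358210026328562650316800]]

def polyT : List (List ℕ) :=
  [[42484879782516118471535515298558769963517299408121267655790374321082377685250949588495195321735172719178185271335920461986922496, 3496903788436617961650044954953565916046032896, 1621296732075415601664239248545324341415553846329925521872888257460704304008102248067212203454261517476315723496161280, 6052023492848818752877970325504000, 99645374065549952673258668032, 26897377915780207371916562213291481166749294412582693158149439319119775404967617437913183399461257216, 118253764057497600, 120444682240, 12091588918606743707106400109532234777577718148709515899820358210026328562650316800],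
  [5194985220734749096582706002325898048770670592, 5098886900433860368683402531477391458574823256161781543817896539571149642979389615194322766351801149818325941023145984, 230592207875002911015306295781621760, 56848839852685239282394977049612761102190578808077848507204778085874124144761435335121064201353992924561408, 3539542321373623361053856815031845907400354881022673449189844087500780156768545584085410302979473408, 1409357835594104832, 186663541189113652238009648270079137662247091981822189651281813458508025596453042572492800, 506120],
  [3695620081928870365899981811538779002659793975706977606485702540645925519342777590092799333615352813436385401816219648, 155598878135576410502332356608655360, 111675886745886351376533315133456821779469943530844168335917329781412453045921987746220757826691572032339968, 3010680616573443824943104, 403103640469312258772142635342000999467018147861456052684610951036525825407477192473640209219584, 710157926400, 620420],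
  [138899708321874470223241771598479360, 11623313836177741389978690672805604480587839172382886192068981819780023147659757326924797105188742082068480, 721765794215580412149760, 494426658780328611063157537725178378195908820421837296425257654695837500000341384942737302749184, 5802266460160, 231931554742344339433412682972401879430099779285278049771033540767849998668791808000],
  [57997409059014652782206514497670340888957664812462366078474990859090678250900888046065902667008962251980800, 12325574884186962424193159473062940234175283695761008466571730406546169562544457562398499694719270912, 1782819037416259584, 390126632960, 208394496763075076389663408849685888400765589502293292318732997666561496806882017280],
  [1244014526662389035696128, 59566454985827100091062380656936089507976207462164224379831094985934420346956802075234815442944, 289573617991138354770920329499267845874458837676974713244194766604303029345099252110458880, 1299080],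
  [209779844198226213661608097921335354741051882772332841335225324639649017181202096172331813568512, 1381807554560, 620420],
  [1377129594880, 91424801978215375258634706923459624524627849092603163742994130029287890638507868160],
  [48996843600324161512506944451501244768571927661342476470476279385028401241490718720]]

def polyN : List (List ℕ) :=
  [[152528859924323941013158315387665317503257896941528350187252963920341837013881780140279444760120903906403782571851776000000000000000000, 169846599586203619040967236759804853819809361937049693049551283061209356696288482631294711563186472603269537464320000000000000000, 856822867030825961947580243902464000000000000, 952485452443424997594565181440000000000, 54246434558737698839288989134107067562098990199191555323002296164936416599308604180616904918728232140800000000, 30597033655890083840000000, 5530887085096960000, 28907823742362079385783586671302784855326502393301641766627555443981960875237192394342400, 3542774762304926315179577857325815228678648450829938697351244240306110114463481856],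
  [44066374401277765229884756034049802240000000000000000, 22766707674489571559614813778739200000000000000, 3170281691327169498024321636066238335409128769771678975573172385288901763309946000154134624062128660886323200000000000, 756665931520356673503148056834592243165606967579015995469044674925393960088751682603709238929977769984000000000, 3819083446257618780160000000, 28630152735256802308922122952440255533323109917177112071471350453773852503766027629374734336000000, 2059502213572242058325227670563577098387197837857009599647097190443358075732627990511616000, 2598374482485375425304932903594956652227378455896974257045428185137570629120163840],
  [44734117130232347316091158857643380258501800972480031248220735915032083967386874060203694373774723984826302464000000000000000, 7851792651826056206112408494906837177344807623020454004281231322890449276525919689187767602877358617395200000000000000, 154648832344266237259284480000000000, 19568055938431791923200000000, 1389723533086162661345495241897213183322595370981164043049654620278083150568302352323200417792000000, 618627072000000, 27786800],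
  [695071899987431043997315891200000000000000, 904921171436886550380544000000000000, 54668830792718190271064235055945381834529119926905944170272381141121246869520563051994556074557440000000000, 1337769666548141480199448924580059250619821018275817519051801670003985457393894028181388656640000000, 16999776256000000, 30705746223951508702422553804603859404530134533634564771983362127218403717918228480000],
  [130078940503788522880253828128593011839161452030867207873812400114363403525383783695710862391828807680000000000000, 597930355319071167107942355540529407862173097005404801274726051642811801167012318031330158418329600000000000, 996386886018662400000000, 5070122975097624658965930644071031406473351549071202633027073912867322821349943529177088000000, 1233834186077146451955402987858574870921303648603199594178844232154719144191302041600000],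
  [16508225909103263744000000000000, 10625727615467520000000000, 157358001522370516365480401448242678487009931219634912602197978762985377324389268235223040000000, 25996400000],
  [7087751300664997266670076724138861248943680969933640199418004505885930519523223161422007500800000000000, 1004572296690789118782493621973818097114538349037977460247323932817328708107287113236480000000000, 832792000000],
  [85052620800000000000, 2794600000000],
  [4899684360032416151250694445150124476857192766134247647047627938502840124149071872000000000]]

def polyS : List (List ℕ) :=
  [[3191901112898703081250332771112493327392596284917056742536114446390346200162747863678247407996306084149125049174143795200000000000000000, 3335231080989438234256232300957247614012973306816074481347803712820092938417958659599215931178164808699335753596928000000000000000, 1934365491306078085388574740447232000000000000, 3112013822537429384955701493760000000000, 34850817877761466927109234033405066540660592054384205510775179549267532601330075730188399984509347430400000000, 6902700109407039551929255059744018836539005798776391578905625526682256472378042762573060348313600000000, 5808857368494080000, 264359116800, 3542774762304926315179577857325815228678648450829938697351244240306110114463481856],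
  [411940606828470302711270420959293603840000000000000000, 343363467288460213631890408813363200000000000000, 4569352242933173509425343940637570606514552889903660524108043702137815379341828410692208380718570993300275200000000000, 2442557779232012583335890789080096336179229592984674893732845675147315545252895655925832754907278475264000000000, 2005123588345330401280000000, 221910222766080000000, 2157728409435405484473592963227341273104304533656583404190391955410781423653316345200640000, 2598374482485375425304932903594956652227378455896974257045428185137570629120163840],
  [319924135567033057779738725622254886023859244327814578442122807986550799100615900726101010505799374737455972352000000000000000, 162358483930266087979970166617782932787055783207099094685418010713095477955010091105401306903569233367531520000000000000, 273258445259166860621905920000000000, 42809895125393394892800000000, 699180272866445712979903882700389510426309996476030790429221579082393325776459509728041500672000000, 11262167589657048883404583655924939099015609335301876029257089051927765037785351297433600000, 27786800],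
  [13273038358712936634934047539200000000000000, 2208755489310751368151040000000000000, 114785706155999058241909083031758891923277747866797860179126117369478989107732971071329783697637376000000000, 1700179055384681202070919076449610533217825424484860747705016579245568646056867349599837224960000000, 10933239808000000, 30705746223951508702422553804603859404530134533634564771983362127218403717918228480000],
  [5774211084221201324600859184511017519465347881906086487181875144623796806928148373076385880913037230080000000000000, 149767773866454619829063171281509664908090479826464431393770572573612563673719946646698215237222400000000000, 1908534860473958400000000, 4793626554171309563543971604863915254588887738181734837728905799737452834882220963397632000000, 1233834186077146451955402987858574870921303648603199594178844232154719144191302041600000],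
  [124043488961595703296000000000000, 1717364148142080000000000, 221823040374766053422604095498797624005304899165031347440537808814658742398567605736570880000000, 25996400000],
  [20831080009554887207977202998776996436783746514758025431798250321737635955665777980927796838400000000000, 479915101883357648058939882466144463647965208263028935949246564127764784394327327506432000000000, 832792000000],
  [136797224960000000000, 2794600000000],
  [4899684360032416151250694445150124476857192766134247647047627938502840124149071872000000000]]

def polyE : List (List ℕ) :=
  [[152528859924323941013158315387665317503257896941528350187252963920341837013881780140279444760120903906403782571851776000000000000000000, 1466823862536088805059865213004677120000000000000000, 856822867030825961947580243902464000000000000, 110290280506574558556466951900535278545986671890468286808322885180912495624109203452770144200318789709987840000000000, 54246434558737698839288989134107067562098990199191555323002296164936416599308604180616904918728232140800000000, 3542894451479991580681531479109126872827155888999542964556400915135114131800385732862412052234240000000, 5530887085096960000, 249652838400, 3542774762304926315179577857325815228678648450829938697351244240306110114463481856],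
  [1378688437791551058100240689539212408550620683511140096900008091928267986103279740650929860011794619427867108311040000000000000000, 992110163811905184135050848785300258415074100189469207100787492197798163123976315850888275611612618861366476800000000000000, 11690191783091502656491251302400000000000, 7999080079426746576797696000000000, 1899683062069518663680000000, 32869384716288000000, 1849390431197453048498594618703695881640655023170776634551705854502534709135902158880768000, 90818051430611838394615194962014099887476714372955207187427372289086425839194603520],
  [211524338632614356811463557906432000000000000000, 7200341895956683934557302431582124829888019639723219612216179805477308875244377564214876438232812266455040000000000000, 16607608922405284422583241043615662276092645053478717000989890821850892589804718469308283555434484203520000000000, 3300764207188969226523318950802034547091934149854835118060786716763054952985316478618628706533376000000000, 372337452604988292608818047689306267028929812347410681136478891612301331701834525194214965248000000, 35625369600000, 25018000],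
  [16553113485157834243651096854826158492992786252999831718870231949310524297940876986955547723710471340032000000000000000, 1591566631935586403876864000000000000, 647154881554165006336000000000, 73155834355384320000000, 2810131251200000, 189600000],
  [1001561651159519836497422684245770274597064897152381538012205376105829051643885128105079393861951815680000000000000, 932794625396744665857439605366770265001101883303360729644299907831279834272507712487406486264217600000000000, 156464056982650358976445982006866856874020750697115479018466228883901452937905955356556027494400000000, 11879056025543040944471712161118288704323322369521510896294598170726573659476373989752832000000, 305931963132128373604708428071754147580967561085395621437370093555627121559082106880000],
  [37826014745261506560000000000000, 16110186104094720000000000, 1400100618240000000, 26257200000],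
  [7268776958718159604414635862464304034740247008823874768566333393475040576435785310116039884800000000000, 1532682281912137412659439373854947594262839205093272560647626202469514512483404593758208000000000, 68896293096203136277024736080169305172695640876056135603477262484708312135761920000000000],
  [43958927360000000000, 3828800000000],
  [1209158891860674370710640010953223477757771814870951589982035821002632856265031680000000000]]

def polyW : List (List ℕ) :=
  [[3191901112898703081250332771112493327392596284917056742536114446390346200162747863678247407996306084149125049174143795200000000000000000, 3335231080989438234256232300957247614012973306816074481347803712820092938417958659599215931178164808699335753596928000000000000000, 1934365491306078085388574740447232000000000000, 3112013822537429384955701493760000000000, 34850817877761466927109234033405066540660592054384205510775179549267532601330075730188399984509347430400000000, 6902700109407039551929255059744018836539005798776391578905625526682256472378042762573060348313600000000, 5808857368494080000, 264359116800, 3542774762304926315179577857325815228678648450829938697351244240306110114463481856],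
  [261052460119448211826174197632157614080000000000000000, 271948191950133768029289811279872000000000000000, 4042406155627397034382511308800000000000, 3055894708668004348490168099387299293350765881704514775032903964104622917302314796341901191879638122496000000000, 1668918617163054448640000000, 323862008954880000000, 1947616627060616474646959911367460056357761718970350439095000619469958057056590513569792000, 90818051430611838394615194962014099887476714372955207187427372289086425839194603520],
  [133306740181152919022989451013314675825124344289169879965842679303315658519048068863059740876334667873879326720000000000000000, 86650562163148756998325922729937111534104230808151682523930613497657980006882316449607342723580704902348800000000000000, 6791381460645713211525383489874621796139872042355589265310468527278786729218175532000758070225278074880000000000, 75139491705430579609600000000, 520973442917254045923081450957442905151433343048515588143345241314313696892964400206530478080000000, 47288810424975989368522339135005626635284462727489502502471852392691234155018661239193600000, 25018000],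
  [625256433904686209158034227200000000000000, 14845109899650325072645400857878387196488796430378736751131939174364427094175451822659586504209203200000000000000, 231231693367803904000000000000, 9611050044631516340172368959496274954611771369603191154258733013287367449085534500866605711360000000, 4115922944000000, 189600000],
  [9103491258805755859435520000000000000, 2821533314045286809600000000000, 69088342931342124242882564065455609835091408651227863845916231855588474588779941542402352742400000000, 16549937152000000, 305931963132128373604708428071754147580967561085395621437370093555627121559082106880000],
  [2648244546961695967481120280325235259518639382248613090767013118902264699994726358200313391874048000000000000, 162602318760361791585913002942843807775044640783946822955746899565102963345732849797410324480000000000, 939534581760000000, 26257200000],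
  [13307526669926400000000000, 501170631442436816526304776220100231060095604966876759382943152251509592608623378300928000000000, 68896293096203136277024736080169305172695640876056135603477262484708312135761920000000000],
  [10789847040000000000, 3828800000000],
  [1209158891860674370710640010953223477757771814870951589982035821002632856265031680000000000]]

/-- Homogenization of the second partial derivative `f_xx`. -/
def formXX (a b c : ℝ) : ℝ :=
  178 * c ^ 4 - 156 * b * c ^ 3 + 198 * a * c ^ 3 + 188 * b ^ 2 * c ^ 2 - 768 * a * b * c ^ 2 -
  1596 * a ^ 2 * c ^ 2 - 208 * b ^ 3 * c + 150 * a * b ^ 2 * c - 120 * a ^ 2 * b * c - 1280 * a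
  ^ 3 * c + 80 * b ^ 4 - 492 * a * b ^ 3 - 672 * a ^ 2 * b ^ 2 + 1780 * a ^ 3 * b + 2010 * a ^ 4

/-- Homogenization of the second partial derivative `f_xy`. -/
def formXY (a b c : ℝ) : ℝ :=
  -46 * c ^ 4 + 246 * b * c ^ 3 - 156 * a * c ^ 3 - 120 * b ^ 2 * c ^ 2 + 376 * a * b * c ^ 2 -
  384 * a ^ 2 * c ^ 2 + 160 * b ^ 3 * c - 624 * a * b ^ 2 * c + 150 * a ^ 2 * b * c - 40 * a ^ 3
  * c + 125 * b ^ 4 + 320 * a * b ^ 3 - 738 * a ^ 2 * b ^ 2 - 448 * a ^ 3 * b + 445 * a ^ 4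

/-- Homogenization of the second partial derivative `f_yy`. -/
def formYY (a b c : ℝ) : ℝ :=
  -160 * c ^ 4 - 708 * b * c ^ 3 + 246 * a * c ^ 3 + 1356 * b ^ 2 * c ^ 2 - 240 * a * b * c ^ 2
  + 188 * a ^ 2 * c ^ 2 + 2400 * b ^ 3 * c + 480 * a * b ^ 2 * c - 624 * a ^ 2 * b * c + 50 * a
  ^ 3 * c - 1110 * b ^ 4 + 500 * a * b ^ 3 + 480 * a ^ 2 * b ^ 2 - 492 * a ^ 3 * b - 112 * a ^ 4

/-- Homogenization of the hessian determinant of `f`. -/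
def form (a b c : ℝ) : ℝ := formXX a b c * formYY a b c - formXY a b c ^ 2

theorem val_polyA (X Y : ℝ) : val polyA (X, Y) = form (X - 327680) (Y - 327680) 32768 := by
  simp only [val, posPart, negPart, polyA, List.map, ev₂, ev, base, Nat.reduceMod, Nat.reduceDiv,
    form, formXX, formXY, formYY]
  push_cast
  ring

theorem val_polyT (Y X : ℝ) : val polyT (Y, X) = form (X - 327680) (Y - 327680) 32768 := by
  simp only [val, posPart, negPart, polyT, List.map, ev₂, ev, base, Nat.reduceMod, Nat.reduceDiv,
    form, formXX, formXY, formYY]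
  push_cast
  ring

theorem val_polyN (U V : ℝ) : val polyN (U, V) = form (10 * (V - 327680)) 3276800 U := by
  simp only [val, posPart, negPart, polyN, List.map, ev₂, ev, base, Nat.reduceMod, Nat.reduceDiv,
    form, formXX, formXY, formYY]
  push_cast
  ring

theorem val_polyS (U V : ℝ) : val polyS (U, V) = form (10 * (V - 327680)) (-3276800) U := by
  simp only [val, posPart, negPart, polyS, List.map, ev₂, ev, base, Nat.reduceMod, Nat.reduceDiv,
    form, formXX, formXY, formYY]
  push_cast
  ring

theorem val_polyE (U V : ℝ) : val polyE (U, V) = form 3276800 (10 * (V - 327680)) U := by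
  simp only [val, posPart, negPart, polyE, List.map, ev₂, ev, base, Nat.reduceMod, Nat.reduceDiv,
    form, formXX, formXY, formYY]
  push_cast
  ring

theorem val_polyW (U V : ℝ) : val polyW (U, V) = form (-3276800) (10 * (V - 327680)) U := by
  simp only [val, posPart, negPart, polyW, List.map, ev₂, ev, base, Nat.reduceMod, Nat.reduceDiv,
    form, formXX, formXY, formYY]
  push_cast
  ring

theorem posPart_polyA_lt : ev₂ 655362 655362 (posPart polyA) < base := by
  simp only [posPart, polyA, List.map, ev₂, ev, base, Nat.reduceMod]
  norm_num

theorem posPart_polyT_lt : ev₂ 655362 655362 (posPart polyT) < base := by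
  simp only [posPart, polyT, List.map, ev₂, ev, base, Nat.reduceMod]
  norm_num

theorem posPart_polyN_lt : ev₂ 655362 655362 (posPart polyN) < base := by
  simp only [posPart, polyN, List.map, ev₂, ev, base, Nat.reduceMod]
  norm_num

theorem posPart_polyS_lt : ev₂ 655362 655362 (posPart polyS) < base := by
  simp only [posPart, polyS, List.map, ev₂, ev, base, Nat.reduceMod]
  norm_num

theorem posPart_polyE_lt : ev₂ 655362 655362 (posPart polyE) < base := by
  simp only [posPart, polyE, List.map, ev₂, ev, base, Nat.reduceMod]
  norm_num

theorem posPart_polyW_lt : ev₂ 655362 655362 (posPart polyW) < base := by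
  simp only [posPart, polyW, List.map, ev₂, ev, base, Nat.reduceMod]
  norm_num

end Polynomials

noncomputable section Cells

/-- The hessian curve, in terms of the explicit form. -/
def curve : Set (ℝ × ℝ) := {p | form p.1 p.2 1 = 0}

theorem form_eq_zero_iff {a b c : ℝ} (hc : c ≠ 0) : form a b c = 0 ↔ (a / c, b / c) ∈ curve := by
  have h : form a b c = c ^ 8 * form (a / c) (b / c) 1 := by
    obtain ⟨x, rfl⟩ : ∃ x, a = c * x := ⟨a / c, by field_simp⟩
    obtain ⟨y, rfl⟩ : ∃ y, b = c * y := ⟨b / c, by field_simp⟩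
    rw [mul_div_cancel_left₀ _ hc, mul_div_cancel_left₀ _ hc]
    simp only [form, formXX, formXY, formYY]
    ring
  rw [h, mul_eq_zero, or_iff_right (pow_ne_zero _ hc)]
  rfl

/-- A piece of the plane in which the curve is a graph. The piece `hor s w t z` is the
rectangle `[s, s + w] × [t, t + z]` in the coordinates `X = 32768 (x + 10)`, `Y = 32768 (y + 10)`,
with parameter `X`; the piece `ver s w t z` is the rectangle `[t, t + z] × [s, s + w]`, with
parameter `Y`; the pieces `north t z` and `south t z` are truncated sectors going to infinity. -/
inductive Cell
  | hor (s w t z : ℕ)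
  | ver (s w t z : ℕ)
  | north (t z : ℕ)
  | south (t z : ℕ)

namespace Cell

def poly : Cell → List (List ℕ)
  | hor _ _ _ _ => polyA
  | ver _ _ _ _ => polyT
  | north _ _ => polyN
  | south _ _ => polyS

def start : Cell → ℕ
  | hor s _ _ _ => s
  | ver s _ _ _ => s
  | north _ _ => 0
  | south _ _ => 0

def width : Cell → ℕ
  | hor _ w _ _ => w
  | ver _ w _ _ => w
  | north _ _ => 327680
  | south _ _ => 327680

def low : Cell → ℕ
  | hor _ _ t _ => t
  | ver _ _ t _ => t
  | north t _ => t
  | south t _ => t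

def height : Cell → ℕ
  | hor _ _ _ z => z
  | ver _ _ _ z => z
  | north _ z => z
  | south _ z => z

/-- Whether the cell is unbounded. -/
def isTail : Cell → Bool
  | hor _ _ _ _ => false
  | ver _ _ _ _ => false
  | north _ _ => true
  | south _ _ => true

/-- Range of the parameter. -/
def dom : Cell → Set ℝ
  | hor s w _ _ => Set.Icc s (s + w)
  | ver s w _ _ => Set.Icc s (s + w)
  | north _ _ => Set.Ioc 0 327680
  | south _ _ => Set.Ioc 0 327680

/-- Parametrization of the plane. -/
def param : Cell → ℝ × ℝ → ℝ × ℝ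
  | hor _ _ _ _, q => ((q.1 - 327680) / 32768, (q.2 - 327680) / 32768)
  | ver _ _ _ _, q => ((q.2 - 327680) / 32768, (q.1 - 327680) / 32768)
  | north _ _, q => (10 * (q.2 - 327680) / q.1, 3276800 / q.1)
  | south _ _, q => (10 * (q.2 - 327680) / q.1, -3276800 / q.1)

/-- The region of the plane covered by a cell. -/
def region (c : Cell) : Set (ℝ × ℝ) :=
  c.param '' (c.dom ×ˢ Set.Icc (c.low : ℝ) (c.low + c.height))

/-- The intersection of a cell with the square `[-10, 10] ^ 2`, in rescaled coordinates. -/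
def trace : Cell → Box
  | hor s w t z => ⟨s, Nat.add s w, t, Nat.add t z⟩
  | ver s w t z => ⟨t, Nat.add t z, s, Nat.add s w⟩
  | north t z => ⟨t, Nat.add t z, 655360, 655360⟩
  | south t z => ⟨t, Nat.add t z, 0, 0⟩

/-- Checks that the curve is a graph in the given cell. -/
def check (c : Cell) : Bool :=
  and (Nat.ble (Nat.add c.start c.width) 655360) (and (Nat.ble (Nat.add c.low c.height) 655360)
    (graphCheck (shiftY c.low (shiftX c.start c.poly)) c.width c.height))

theorem dom_subset (c : Cell) : c.dom ⊆ Set.Icc (c.start : ℝ) (c.start + c.width) := by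
  cases c with
  | hor s w t z => exact subset_rfl
  | ver s w t z => exact subset_rfl
  | north t z => intro a ha; simpa [start, width] using Set.Ioc_subset_Icc_self ha
  | south t z => intro a ha; simpa [start, width] using Set.Ioc_subset_Icc_self ha

theorem isPreconnected_dom (c : Cell) : IsPreconnected c.dom := by
  cases c with
  | hor s w t z => exact isPreconnected_Icc
  | ver s w t z => exact isPreconnected_Icc
  | north t z => exact isPreconnected_Ioc
  | south t z => exact isPreconnected_Ioc

theorem nonempty_dom (c : Cell) : c.dom.Nonempty := by
  cases c with
  | hor s w t z => exact ⟨s, by simp [dom]⟩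
  | ver s w t z => exact ⟨s, by simp [dom]⟩
  | north t z => exact ⟨1, by norm_num [dom]⟩
  | south t z => exact ⟨1, by norm_num [dom]⟩

theorem continuousOn_param (c : Cell) : ContinuousOn c.param (c.dom ×ˢ Set.univ) := by
  have h {t : ℝ × ℝ} (ht : t ∈ Set.Ioc (0 : ℝ) 327680 ×ˢ (Set.univ : Set ℝ)) : t.1 ≠ 0 :=
    ht.1.1.ne'
  cases c with
  | hor s w t z => unfold param; fun_prop
  | ver s w t z => unfold param; fun_prop
  | north t z =>
    unfold param dom
    exact (ContinuousOn.div (by fun_prop) (by fun_prop) fun q hq => h hq).prodMk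
      (ContinuousOn.div (by fun_prop) (by fun_prop) fun q hq => h hq)
  | south t z =>
    unfold param dom
    exact (ContinuousOn.div (by fun_prop) (by fun_prop) fun q hq => h hq).prodMk
      (ContinuousOn.div (by fun_prop) (by fun_prop) fun q hq => h hq)

theorem val_poly_eq_zero_iff (c : Cell) {a : ℝ} (ha : a ∈ c.dom) (b : ℝ) :
    val c.poly (a, b) = 0 ↔ c.param (a, b) ∈ curve := by
  cases c with
  | hor s w t z => rw [poly, val_polyA, form_eq_zero_iff (by norm_num)]; rfl
  | ver s w t z => rw [poly, val_polyT, form_eq_zero_iff (by norm_num)]; rfl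
  | north t z => rw [poly, val_polyN, form_eq_zero_iff ha.1.ne']; rfl
  | south t z => rw [poly, val_polyS, form_eq_zero_iff ha.1.ne']; rfl

theorem posPart_poly_lt (c : Cell) : ev₂ 655362 655362 (posPart c.poly) < base := by
  cases c with
  | hor s w t z => exact posPart_polyA_lt
  | ver s w t z => exact posPart_polyT_lt
  | north t z => exact posPart_polyN_lt
  | south t z => exact posPart_polyS_lt

theorem exists_graph_of_check {c : Cell} (h : c.check = true) :
    ∃ g : ℝ → ℝ, ContinuousOn g c.dom ∧
      curve ∩ c.region = (fun a => c.param (a, g a)) '' c.dom := by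
  simp only [check, Bool.and_eq_true, Nat.ble_eq, Nat.add_eq] at h
  obtain ⟨g, hg, hg'⟩ := graph_of_graphCheck_shift h.2.2
    (lt_of_le_of_lt (ev₂_mono (by omega) (by omega) _) c.posPart_poly_lt)
  refine ⟨g, hg.mono c.dom_subset, ?_⟩
  ext p
  constructor
  · rintro ⟨hp, ⟨a, b⟩, ⟨ha, hb⟩, rfl⟩
    have := ((hg' a (c.dom_subset ha)).2 b hb).1 ((c.val_poly_eq_zero_iff ha b).2 hp)
    exact ⟨a, ha, by rw [this]⟩
  · rintro ⟨a, ha, rfl⟩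
    obtain ⟨h₁, h₂⟩ := hg' a (c.dom_subset ha)
    exact ⟨(c.val_poly_eq_zero_iff ha _).1 ((h₂ _ h₁).2 rfl), (a, g a), ⟨ha, h₁⟩, rfl⟩

theorem isPreconnected_arc {c : Cell} (h : c.check = true) : IsPreconnected (curve ∩ c.region) := by
  obtain ⟨g, hg, he⟩ := exists_graph_of_check h
  rw [he]
  refine c.isPreconnected_dom.image _ (c.continuousOn_param.comp (continuousOn_id.prodMk hg) ?_)
  exact fun a ha => ⟨ha, Set.mem_univ _⟩

theorem nonempty_arc {c : Cell} (h : c.check = true) : (curve ∩ c.region).Nonempty := by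
  obtain ⟨g, hg, he⟩ := exists_graph_of_check h
  rw [he]
  exact c.nonempty_dom.image _

theorem not_isBounded_arc {c : Cell} (h : c.check = true) (ht : c.isTail = true) :
    ¬ Bornology.IsBounded (curve ∩ c.region) := by
  obtain ⟨g, hg, he⟩ := exists_graph_of_check h
  rw [he]
  intro hb
  obtain ⟨r, hr⟩ := hb.exists_norm_le
  have key (y : ℝ) (hy : y ∈ Set.Ioc 0 327680) (hle : 3276800 / y ≤ r) : 3276800 ≤ r * y := by
    rwa [div_le_iff₀ hy.1] at hle
  have hy : 1 / (|r| + 1) ∈ Set.Ioc (0 : ℝ) 327680 := by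
    refine ⟨by positivity, ?_⟩
    rw [div_le_iff₀ (by positivity)]
    linarith [abs_nonneg r]
  have hfin (hle : 3276800 / (1 / (|r| + 1)) ≤ r) : False := by
    rw [div_div_eq_mul_div, div_one] at hle
    linarith [le_abs_self r, abs_nonneg r]
  cases c with
  | hor s w t z => simp [isTail] at ht
  | ver s w t z => simp [isTail] at ht
  | north t z =>
    refine hfin ((le_trans (le_abs_self _) ?_).trans (hr _ ⟨_, hy, rfl⟩))
    exact norm_snd_le (param (north t z) (_, g _))
  | south t z =>
    refine hfin ((le_trans ?_ (norm_snd_le _)).trans (hr _ ⟨_, hy, rfl⟩))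
    refine le_trans (le_of_eq ?_) (neg_abs_le _ |> neg_le.1)
    simp only [param]
    ring

theorem isBounded_region {c : Cell} (ht : c.isTail = false) : Bornology.IsBounded c.region := by
  have key : IsCompact (c.dom ×ˢ Set.Icc (c.low : ℝ) (c.low + c.height)) := by
    cases c with
    | hor s w t z => exact isCompact_Icc.prod isCompact_Icc
    | ver s w t z => exact isCompact_Icc.prod isCompact_Icc
    | north t z => simp [isTail] at ht
    | south t z => simp [isTail] at ht
  exact (key.image_of_continuousOn
    (c.continuousOn_param.mono (Set.prod_mono_right (Set.subset_univ _)))).isBounded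

theorem mem_region_of_mem_trace {c : Cell} {X Y : ℝ} (h : c.trace.Mem X Y) :
    ((X - 327680) / 32768, (Y - 327680) / 32768) ∈ c.region := by
  cases c with
  | hor s w t z =>
    simp only [trace, Box.Mem, Nat.add_eq, Nat.cast_add] at h
    exact ⟨(X, Y), h, rfl⟩
  | ver s w t z =>
    simp only [trace, Box.Mem, Nat.add_eq, Nat.cast_add] at h
    exact ⟨(Y, X), ⟨h.2, h.1⟩, rfl⟩
  | north t z =>
    simp only [trace, Box.Mem, Nat.add_eq, Nat.cast_add] at h
    have hY : Y = 655360 := le_antisymm h.2.2 h.2.1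
    subst hY
    refine ⟨(327680, X), ⟨by norm_num [dom], h.1⟩, ?_⟩
    simp only [param, Prod.mk.injEq]
    constructor <;> ring
  | south t z =>
    simp only [trace, Box.Mem, Nat.add_eq, Nat.cast_add, Nat.cast_zero] at h
    have hY : Y = 0 := le_antisymm h.2.2 h.2.1
    subst hY
    refine ⟨(327680, X), ⟨by norm_num [dom], h.1⟩, ?_⟩
    simp only [param, Prod.mk.injEq]
    constructor <;> ring

end Cell

/-- Radial retraction of the plane onto the square `[-10, 10] ^ 2`, in rescaled coordinates. -/
def retract (p : ℝ × ℝ) : ℝ × ℝ :=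
  (327680 * p.1 / max 10 (max |p.1| |p.2|) + 327680,
    327680 * p.2 / max 10 (max |p.1| |p.2|) + 327680)

theorem continuous_retract : Continuous retract := by
  have h (p : ℝ × ℝ) : max 10 (max |p.1| |p.2|) ≠ 0 := by positivity
  unfold retract
  exact ((Continuous.div (by fun_prop) (by fun_prop) h).add continuous_const).prodMk
    ((Continuous.div (by fun_prop) (by fun_prop) h).add continuous_const)

theorem Cell.retract_mem_trace {c : Cell} (h : c.check = true) {p : ℝ × ℝ} (hp : p ∈ c.region) :
    c.trace.Mem (retract p).1 (retract p).2 := by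
  simp only [check, Bool.and_eq_true, Nat.ble_eq, Nat.add_eq] at h
  obtain ⟨⟨a, b⟩, ⟨ha, hb⟩, rfl⟩ := hp
  have hw : (c.start : ℝ) + c.width ≤ 655360 := by exact_mod_cast h.1
  have hz : (c.low : ℝ) + c.height ≤ 655360 := by exact_mod_cast h.2.1
  have hb0 : (0 : ℝ) ≤ b := le_trans (by positivity) hb.1
  have hb1 : b ≤ 655360 := hb.2.trans hz
  have ha0 : (0 : ℝ) ≤ a := le_trans (by positivity) (c.dom_subset ha).1
  have ha1 : a ≤ 655360 := (c.dom_subset ha).2.trans hw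
  have sq {X Y : ℝ} (hX : 0 ≤ X) (hX' : X ≤ 655360) (hY : 0 ≤ Y) (hY' : Y ≤ 655360) :
      max 10 (max |(X - 327680) / 32768| |(Y - 327680) / 32768|) = 10 := by
    refine max_eq_left (max_le ?_ ?_) <;> rw [abs_le] <;> constructor <;> linarith
  have sec {x y : ℝ} (hy : 10 ≤ |y|) (hx : |x| ≤ |y|) : max 10 (max |x| |y|) = |y| := by
    rw [max_eq_right hx, max_eq_right hy]
  cases c with
  | hor s w t z =>
    simp only [retract, param, sq ha0 ha1 hb0 hb1, trace, Box.Mem, Nat.add_eq, Nat.cast_add]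
    simp only [dom, Set.mem_Icc, low, height] at ha hb
    refine ⟨⟨?_, ?_⟩, ?_, ?_⟩ <;> linarith
  | ver s w t z =>
    simp only [retract, param, sq hb0 hb1 ha0 ha1, trace, Box.Mem, Nat.add_eq, Nat.cast_add]
    simp only [dom, Set.mem_Icc, low, height] at ha hb
    refine ⟨⟨?_, ?_⟩, ?_, ?_⟩ <;> linarith
  | north t z =>
    have ha' : 0 < a := ha.1
    have e : |3276800 / a| = 3276800 / a := abs_of_pos (by positivity)
    have hm : max 10 (max |10 * (b - 327680) / a| |3276800 / a|) = 3276800 / a := by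
      rw [sec, e]
      · rw [e, le_div_iff₀ ha']
        linarith [ha.2]
      · rw [e, abs_div, abs_of_pos ha']
        refine div_le_div_of_nonneg_right ?_ ha'.le
        rw [abs_le]
        constructor <;> linarith
    have e₁ : 327680 * (10 * (b - 327680) / a) / (3276800 / a) + 327680 = b := by
      field_simp; ring
    have e₂ : 327680 * (3276800 / a) / (3276800 / a) + 327680 = 655360 := by
      field_simp; ring
    simp only [low, height, Set.mem_Icc] at hb
    simp only [retract, param, hm, e₁, e₂, trace, Box.Mem, Nat.add_eq, Nat.cast_add]
    exact ⟨hb, by norm_num⟩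
  | south t z =>
    have ha' : 0 < a := ha.1
    have e : |-3276800 / a| = 3276800 / a := by
      rw [neg_div, abs_neg]; exact abs_of_pos (by positivity)
    have hm : max 10 (max |10 * (b - 327680) / a| |-3276800 / a|) = 3276800 / a := by
      rw [sec, e]
      · rw [e, le_div_iff₀ ha']
        linarith [ha.2]
      · rw [e, abs_div, abs_of_pos ha']
        gcongr
        rw [abs_le]
        constructor <;> linarith
    have e₁ : 327680 * (10 * (b - 327680) / a) / (3276800 / a) + 327680 = b := by
      field_simp; ring
    have e₂ : 327680 * (-3276800 / a) / (3276800 / a) + 327680 = 0 := by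
      field_simp; ring
    simp only [low, height, Set.mem_Icc] at hb
    simp only [retract, param, hm, e₁, e₂, trace, Box.Mem, Nat.add_eq, Nat.cast_add]
    exact ⟨hb, by norm_num⟩

end Cells

noncomputable section Arcs

/-- Whether the form is negative at a grid point. -/
def negAt (X Y : ℕ) : Bool := negN (evalP X Y polyA)

theorem PackP.evalP_eq {p u v : List (List ℕ)} (h : PackP p u v) (x y : ℕ) :
    evalP x y p = ev₂ x y u + base * ev₂ x y v := by
  have hR {l u v : List ℕ} (h : PackR l u v) : evalR x l = ev x u + base * ev x v := by
    induction h with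
    | nil => rfl
    | cons n a b l u v hn h ih =>
      have : evalR x (n :: l) = n + x * evalR x l := rfl
      rw [this, ih, hn]
      simp only [ev, Nat.cast_id]
      ring
  induction h with
  | nil => rfl
  | cons n a b l u v hn h ih =>
    have : evalP x y (n :: l) = evalR x n + y * evalP x y l := rfl
    rw [this, ih, hR hn]
    simp only [ev₂]
    ring

theorem cast_ev₂ (x y : ℕ) (u : List (List ℕ)) : ((ev₂ x y u : ℕ) : ℝ) = ev₂ (x : ℝ) (y : ℝ) u := by
  have h (l : List ℕ) : ((ev x l : ℕ) : ℝ) = ev (x : ℝ) l := by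
    induction l with
    | nil => simp [ev]
    | cons a l ih => simp [ev, ih]
  induction u with
  | nil => simp [ev₂]
  | cons a l ih => simp [ev₂, ih, h]

theorem negAt_iff {X Y : ℕ} (hX : X ≤ 655360) (hY : Y ≤ 655360) :
    negAt X Y = true ↔ val polyA (X, Y) < 0 := by
  rw [negAt, (packP_posPart_negPart polyA).evalP_eq, negN_pack
    (lt_of_le_of_lt (ev₂_mono (by omega) (by omega) _) posPart_polyA_lt), val, sub_neg,
    ← cast_ev₂, ← cast_ev₂, Nat.cast_lt]

namespace Box

/-- Intersection of two boxes. -/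
def inter (b b' : Box) : Box :=
  ⟨cond (Nat.ble b.x₀ b'.x₀) b'.x₀ b.x₀, cond (Nat.ble b.x₁ b'.x₁) b.x₁ b'.x₁,
    cond (Nat.ble b.y₀ b'.y₀) b'.y₀ b.y₀, cond (Nat.ble b.y₁ b'.y₁) b.y₁ b'.y₁⟩

theorem mem_of_mem_inter {b b' : Box} {x y : ℝ} (h : (b.inter b').Mem x y) :
    b.Mem x y ∧ b'.Mem x y := by
  have e₀ (m n : ℕ) : cond (Nat.ble m n) n m = max m n := by
    cases h : Nat.ble m n with
    | true => rw [cond_true, max_eq_right (Nat.le_of_ble_eq_true h)]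
    | false =>
      have : ¬ m ≤ n := fun h' => by rw [Nat.ble_eq_true_of_le h'] at h; exact absurd h (by decide)
      rw [cond_false, max_eq_left (by omega)]
  have e₁ (m n : ℕ) : cond (Nat.ble m n) m n = min m n := by
    cases h : Nat.ble m n with
    | true => rw [cond_true, min_eq_left (Nat.le_of_ble_eq_true h)]
    | false =>
      have : ¬ m ≤ n := fun h' => by rw [Nat.ble_eq_true_of_le h'] at h; exact absurd h (by decide)
      rw [cond_false, min_eq_right (by omega)]
  simp only [inter, Mem, e₀, e₁, Nat.cast_max, Nat.cast_min, max_le_iff, le_min_iff] at h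
  exact ⟨⟨⟨h.1.1.1, h.1.2.1⟩, h.2.1.1, h.2.2.1⟩, ⟨h.1.1.2, h.1.2.2⟩, h.2.1.2, h.2.2.2⟩

/-- Checks that the form takes both signs at the corners of a nonempty box. -/
def signChange (b : Box) : Bool :=
  and (and (and (Nat.ble b.x₀ b.x₁) (Nat.ble b.x₁ 655360))
    (and (Nat.ble b.y₀ b.y₁) (Nat.ble b.y₁ 655360)))
  (and (or (or (negAt b.x₀ b.y₀) (negAt b.x₀ b.y₁)) (or (negAt b.x₁ b.y₀) (negAt b.x₁ b.y₁)))
    (not (and (and (negAt b.x₀ b.y₀) (negAt b.x₀ b.y₁))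
      (and (negAt b.x₁ b.y₀) (negAt b.x₁ b.y₁)))))

theorem exists_zero_of_signChange {b : Box} (h : b.signChange = true) :
    ∃ X Y, b.Mem X Y ∧ val polyA (X, Y) = 0 := by
  by_contra! hcon
  simp only [signChange, Bool.and_eq_true, Nat.ble_eq] at h
  obtain ⟨⟨⟨hx, hx'⟩, hy, hy'⟩, hs, hs'⟩ := h
  have hX : (b.x₀ : ℝ) ≤ b.x₁ := by exact_mod_cast hx
  have hY : (b.y₀ : ℝ) ≤ b.y₁ := by exact_mod_cast hy
  have key {p q : ℝ × ℝ} := mul_pos_of_forall_ne_zero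
    (S := Set.Icc (b.x₀ : ℝ) b.x₁ ×ˢ Set.Icc (b.y₀ : ℝ) b.y₁) (F := val polyA) (x := p) (y := q)
    (isPreconnected_Icc.prod isPreconnected_Icc) (continuous_val _).continuousOn
    fun p hp => hcon p.1 p.2 hp
  have hsame {X Y X' Y' : ℕ} (h : (X = b.x₀ ∨ X = b.x₁) ∧ (Y = b.y₀ ∨ Y = b.y₁))
      (h' : (X' = b.x₀ ∨ X' = b.x₁) ∧ (Y' = b.y₀ ∨ Y' = b.y₁)) : negAt X Y = negAt X' Y' := by
    have hm {X Y : ℕ} (h : (X = b.x₀ ∨ X = b.x₁) ∧ (Y = b.y₀ ∨ Y = b.y₁)) :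
        ((X : ℝ), (Y : ℝ)) ∈ Set.Icc (b.x₀ : ℝ) b.x₁ ×ˢ Set.Icc (b.y₀ : ℝ) b.y₁ := by
      rcases h with ⟨rfl | rfl, rfl | rfl⟩ <;> simp [hX, hY]
    have hp := key (hm h) (hm h')
    rw [Bool.eq_iff_iff, negAt_iff (by omega) (by omega), negAt_iff (by omega) (by omega)]
    constructor <;> intro h0
    · exact neg_of_mul_pos_right hp h0.le
    · exact neg_of_mul_pos_left hp h0.le
  rw [hsame (X := b.x₀) (Y := b.y₁) (X' := b.x₀) (Y' := b.y₀) (by simp) (by simp),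
    hsame (X := b.x₁) (Y := b.y₁) (X' := b.x₀) (Y' := b.y₀) (by simp) (by simp),
    hsame (X := b.x₁) (Y := b.y₀) (X' := b.x₀) (Y' := b.y₀) (by simp) (by simp)] at hs hs'
  revert hs hs'
  cases negAt b.x₀ b.y₀ <;> decide

/-- Checks that two boxes are disjoint. -/
def separated (b b' : Box) : Bool :=
  or (or (Nat.ble (Nat.succ b.x₁) b'.x₀) (Nat.ble (Nat.succ b'.x₁) b.x₀))
    (or (Nat.ble (Nat.succ b.y₁) b'.y₀) (Nat.ble (Nat.succ b'.y₁) b.y₀))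

theorem not_mem_of_separated {b b' : Box} (h : b.separated b' = true) {x y : ℝ}
    (hm : b.Mem x y) : ¬ b'.Mem x y := by
  intro hm'
  simp only [separated, Bool.or_eq_true, Nat.ble_eq, Nat.succ_le_iff] at h
  rcases h with (h | h) | (h | h)
  · exact absurd (Nat.cast_lt (α := ℝ).2 h) (not_lt.2 (hm'.1.1.trans hm.1.2))
  · exact absurd (Nat.cast_lt (α := ℝ).2 h) (not_lt.2 (hm.1.1.trans hm'.1.2))
  · exact absurd (Nat.cast_lt (α := ℝ).2 h) (not_lt.2 (hm'.2.1.trans hm.2.2))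
  · exact absurd (Nat.cast_lt (α := ℝ).2 h) (not_lt.2 (hm.2.1.trans hm'.2.2))

theorem isClosed_mem (b : Box) : IsClosed {q : ℝ × ℝ | b.Mem q.1 q.2} :=
  (isClosed_Icc.prod isClosed_Icc : IsClosed (Set.Icc (b.x₀ : ℝ) b.x₁ ×ˢ Set.Icc (b.y₀ : ℝ) b.y₁))

end Box

/-- The part of the curve in a list of cells. -/
def arc (l : List Cell) : Set (ℝ × ℝ) := {p | p ∈ curve ∧ ∃ c ∈ l, p ∈ c.region}

/-- A closed neighbourhood of an arc. -/
def tube (l : List Cell) : Set (ℝ × ℝ) :=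
  {p | ∃ c ∈ l, c.trace.Mem (retract p).1 (retract p).2}

/-- Checks that consecutive cells of `c :: l` share a point of the curve. -/
def linked (c : Cell) (l : List Cell) : Bool :=
  List.rec (motive := fun _ => Cell → Bool) (fun _ => true)
    (fun d _ ih c => and (c.trace.inter d.trace).signChange (ih d)) l c

theorem isPreconnected_arc {c : Cell} {l : List Cell} (h : linked c l = true)
    (hc : ∀ d ∈ c :: l, d.check = true) : IsPreconnected (arc (c :: l)) := by
  induction l generalizing c with
  | nil => simpa [arc] using Cell.isPreconnected_arc (hc c List.mem_cons_self)
  | cons d l ih =>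
    change (_ && linked d l) = true at h
    rw [Bool.and_eq_true] at h
    have e : arc (c :: d :: l) = (curve ∩ c.region) ∪ arc (d :: l) := by
      ext p
      simp only [arc, List.mem_cons, exists_eq_or_imp, Set.mem_ofPred_eq, Set.mem_union,
        Set.mem_inter_iff]
      tauto
    obtain ⟨X, Y, hm, hv⟩ := Box.exists_zero_of_signChange h.1
    obtain ⟨h₁, h₂⟩ := Box.mem_of_mem_inter hm
    rw [val_polyA, form_eq_zero_iff (by norm_num)] at hv
    rw [e]
    exact IsPreconnected.union _ ⟨hv, Cell.mem_region_of_mem_trace h₁⟩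
      ⟨hv, d, List.mem_cons_self, Cell.mem_region_of_mem_trace h₂⟩
      (Cell.isPreconnected_arc (hc c List.mem_cons_self))
      (ih h.2 fun d hd => hc d (List.mem_cons_of_mem _ hd))

theorem arc_subset_tube {l : List Cell} (h : ∀ c ∈ l, c.check = true) : arc l ⊆ tube l :=
  fun _ ⟨_, c, hc, hp⟩ => ⟨c, hc, Cell.retract_mem_trace (h c hc) hp⟩

theorem isClosed_tube (l : List Cell) : IsClosed (tube l) := by
  have e : tube l = ⋃ c ∈ {c | c ∈ l}, retract ⁻¹' {q | c.trace.Mem q.1 q.2} := by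
    ext p; simp [tube]
  rw [e]
  exact (List.finite_toSet l).isClosed_biUnion fun c _ =>
    c.trace.isClosed_mem.preimage continuous_retract

theorem disjoint_tube {l m : List Cell}
    (h : ∀ c ∈ l, ∀ d ∈ m, c.trace.separated d.trace = true) : Disjoint (tube l) (tube m) :=
  Set.disjoint_left.2 fun _ ⟨c, hc, hp⟩ ⟨d, hd, hp'⟩ =>
    Box.not_mem_of_separated (h c hc d hd) hp hp'

theorem isBounded_arc {l : List Cell} (h : ∀ c ∈ l, c.isTail = false) :
    Bornology.IsBounded (arc l) := by
  have e : arc l ⊆ ⋃ c ∈ {c | c ∈ l}, c.region := fun p ⟨_, c, hc, hp⟩ => by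
    simp only [Set.mem_iUnion]
    exact ⟨c, hc, hp⟩
  exact ((Bornology.isBounded_biUnion (List.finite_toSet l)).2
    fun c hc => Cell.isBounded_region (h c hc)).subset e

theorem not_isBounded_arc {l : List Cell} {c : Cell} (hc : c ∈ l) (h : c.check = true)
    (ht : c.isTail = true) : ¬ Bornology.IsBounded (arc l) :=
  fun hb => Cell.not_isBounded_arc h ht (hb.subset fun _ hp => ⟨hp.1, c, hc, hp.2⟩)

/-- The region of a northern tail, in coordinates at infinity. -/
def Cell.northBox : Cell → Option Box
  | hor _ _ _ _ => none
  | ver _ _ _ _ => none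
  | north t z => some ⟨0, 327680, t, Nat.add t z⟩
  | south _ _ => none

/-- The region of a southern tail, in coordinates at infinity. -/
def Cell.southBox : Cell → Option Box
  | hor _ _ _ _ => none
  | ver _ _ _ _ => none
  | north _ _ => none
  | south t z => some ⟨0, 327680, t, Nat.add t z⟩

theorem exists_mem_region {l : List Cell}
    (h : cover 60 polyA 0 655360 0 655360 (l.map Cell.trace) = true)
    (hN : cover 60 polyN 0 327680 0 655360 (l.filterMap Cell.northBox) = true)
    (hS : cover 60 polyS 0 327680 0 655360 (l.filterMap Cell.southBox) = true)
    (hE : cover 60 polyE 0 327680 0 655360 [] = true)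
    (hW : cover 60 polyW 0 327680 0 655360 [] = true) {p : ℝ × ℝ} (hp : p ∈ curve) :
    ∃ c ∈ l, p ∈ c.region := by
  obtain ⟨x, y⟩ := p
  have bd {r : ℝ} (hr : 10 ≤ r) : 3276800 / r ∈ Set.Icc (0 : ℝ) (327680 : ℕ) := by
    refine ⟨by positivity, ?_⟩
    rw [div_le_iff₀ (by linarith)]
    push_cast
    linarith
  have bd' {q r : ℝ} (hr : 10 ≤ r) (hq : |q| ≤ r) :
      327680 * (q / r) + 327680 ∈ Set.Icc (0 : ℝ) (655360 : ℕ) := by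
    have hq := abs_le.1 hq
    have h₁ : -1 ≤ q / r := by rw [le_div_iff₀ (by linarith)]; linarith
    have h₂ : q / r ≤ 1 := by rw [div_le_iff₀ (by linarith)]; linarith
    push_cast
    constructor <;> linarith
  have mono (p : List (List ℕ)) (hp : ev₂ 655362 655362 (posPart p) < base) :
      ev₂ (327680 + 1) (655360 + 1) (posPart p) < base :=
    lt_of_le_of_lt (ev₂_mono (by omega) (by omega) _) hp
  rcases le_total (max |x| |y|) 10 with hm | hm
  · obtain ⟨hx, hy⟩ := max_le_iff.1 hm
    rw [abs_le] at hx hy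
    obtain ⟨r, hr, hrm⟩ := covered_val h
      (lt_of_le_of_lt (ev₂_mono (by omega) (by omega) _) posPart_polyA_lt)
      (q := (32768 * x + 327680, 32768 * y + 327680))
      (by push_cast; constructor <;> linarith) (by push_cast; constructor <;> linarith)
      (by
        rw [val_polyA, form_eq_zero_iff (by norm_num)]
        convert hp using 2 <;> ring)
    obtain ⟨c, hc, rfl⟩ := List.mem_map.1 hr
    refine ⟨c, hc, ?_⟩
    convert Cell.mem_region_of_mem_trace hrm using 2 <;> ring
  rcases le_total |x| |y| with hxy | hxy
  · rw [max_eq_right hxy] at hm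
    rcases le_total 0 y with h0 | h0
    · rw [abs_of_nonneg h0] at hm hxy
      have hy : 0 < y := by linarith
      have e : 10 * (327680 * (x / y) + 327680 - 327680) / (3276800 / y) = x := by field_simp; ring
      have e' : 3276800 / (3276800 / y) = y := by field_simp
      obtain ⟨r, hr, hrm⟩ := covered_val hN (mono _ posPart_polyN_lt)
        (q := (3276800 / y, 327680 * (x / y) + 327680)) (bd hm) (bd' hm hxy)
        (by rw [val_polyN, form_eq_zero_iff (by positivity), e, e']; exact hp)
      obtain ⟨c, hc, hcr⟩ := List.mem_filterMap.1 hr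
      refine ⟨c, hc, ?_⟩
      cases c with
      | hor s w t z => simp [Cell.northBox] at hcr
      | ver s w t z => simp [Cell.northBox] at hcr
      | south t z => simp [Cell.northBox] at hcr
      | north t z =>
        obtain rfl := Option.some.inj hcr
        simp only [Box.Mem, Nat.add_eq, Nat.cast_add] at hrm
        exact ⟨(_, _), ⟨⟨by positivity, by simpa using (bd hm).2⟩, hrm.2⟩, Prod.ext e e'⟩
    · rw [abs_of_nonpos h0] at hm hxy
      have hy : 0 < -y := by linarith
      have hy' : y ≠ 0 := by linarith
      have e : 10 * (327680 * (x / -y) + 327680 - 327680) / (3276800 / -y) = x := by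
        field_simp; ring
      have e' : -3276800 / (3276800 / -y) = y := by field_simp
      obtain ⟨r, hr, hrm⟩ := covered_val hS (mono _ posPart_polyS_lt)
        (q := (3276800 / -y, 327680 * (x / -y) + 327680)) (bd hm) (bd' hm hxy)
        (by rw [val_polyS, form_eq_zero_iff (by positivity), e, e']; exact hp)
      obtain ⟨c, hc, hcr⟩ := List.mem_filterMap.1 hr
      refine ⟨c, hc, ?_⟩
      cases c with
      | hor s w t z => simp [Cell.southBox] at hcr
      | ver s w t z => simp [Cell.southBox] at hcr
      | north t z => simp [Cell.southBox] at hcr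
      | south t z =>
        obtain rfl := Option.some.inj hcr
        simp only [Box.Mem, Nat.add_eq, Nat.cast_add] at hrm
        exact ⟨(_, _), ⟨⟨by positivity, by simpa using (bd hm).2⟩, hrm.2⟩, Prod.ext e e'⟩
  · rw [max_eq_left hxy] at hm
    rcases le_total 0 x with h0 | h0
    · rw [abs_of_nonneg h0] at hm hxy
      have hx : 0 < x := by linarith
      have e : 10 * (327680 * (y / x) + 327680 - 327680) / (3276800 / x) = y := by field_simp; ring
      have e' : 3276800 / (3276800 / x) = x := by field_simp
      obtain ⟨r, hr, -⟩ := covered_val hE (mono _ posPart_polyE_lt)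
        (q := (3276800 / x, 327680 * (y / x) + 327680)) (bd hm) (bd' hm hxy)
        (by rw [val_polyE, form_eq_zero_iff (by positivity), e, e']; exact hp)
      exact absurd hr List.not_mem_nil
    · rw [abs_of_nonpos h0] at hm hxy
      have hx : 0 < -x := by linarith
      have hx' : x ≠ 0 := by linarith
      have e : 10 * (327680 * (y / -x) + 327680 - 327680) / (3276800 / -x) = y := by
        field_simp; ring
      have e' : -3276800 / (3276800 / -x) = x := by field_simp
      obtain ⟨r, hr, -⟩ := covered_val hW (mono _ posPart_polyW_lt)
        (q := (3276800 / -x, 327680 * (y / -x) + 327680)) (bd hm) (bd' hm hxy)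
        (by rw [val_polyW, form_eq_zero_iff (by positivity), e, e']; exact hp)
      exact absurd hr List.not_mem_nil

end Arcs

section Data

/-- The cells covering the curve, grouped by connected component: first the four unbounded
components, then the ten ovals. -/
def arcCells : List (List Cell) :=
  [[.south 147456 39322, .ver 0 38645 169024 41624, .hor 197932 16436 25864 55535,
    .hor 213360 16058 58647 54429, .hor 228414 13493 92124 45930,
    .hor 241074 12626 119559 43215, .hor 252926 10540 146195 36333,
    .hor 262807 9748 167928 33915, .hor 271957 7702 189089 27110, .hor 279175 6916 205411 24687,
    .hor 285666 5974 220445 21684, .hor 291274 4384 234192 16160, .hor 295347 3233 244362 11930,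
    .hor 298370 1898 252322 6682, .hor 300098 1089 256815 3103, .hor 301080 461 258509 1666,
    .ver 258937 450 301391 350, .ver 258091 902 301320 562, .ver 256916 1305 301101 889,
    .ver 255353 1692 300805 1209, .ver 253274 2208 300373 1619, .ver 250680 2853 299802 2126,
    .ver 247312 3627 299054 2732, .ver 243428 4142 298283 3143, .ver 238512 5174 297171 3949,
    .ver 232307 6592 295711 5055, .ver 225458 7365 294315 5671, .ver 216804 9170 292280 7085,
    .ver 205960 11489 289683 8908, .ver 192668 14065 286548 10939,
    .ver 176543 17027 282754 13284, .ver 157330 20244 278288 15836,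
    .ver 132194 26424 271802 20723, .ver 101010 32858 264070 25828,
    .ver 60946 42124 253771 33179, .ver 14194 49327 242775 38918, .ver 0 17155 229105 54763,
    .south 239206 39322],
   [.south 558694 25232, .ver 0 16927 564086 22275, .ver 15858 15523 554300 20279,
    .ver 30418 14038 545539 18311, .ver 43599 14483 535844 18856, .ver 57116 12999 527880 16886,
    .ver 69256 11620 520811 15056, .ver 80123 11858 513062 15316, .ver 91226 10481 506800 13485,
    .ver 101059 10403 500190 13320, .ver 110811 9026 494971 11489, .ver 119293 7861 490465 9938,
    .ver 126608 7182 486334 9005, .ver 133351 7397 481823 9171, .ver 140195 6233 478648 7615,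
    .ver 145982 5851 475542 7005, .ver 151380 4794 473419 5581, .ver 155830 3839 471904 4293,
    .ver 159435 3599 470513 3738, .ver 162789 2484 470272 2159, .ver 165119 1237 470637 1089,
    .hor 471285 1877 165401 1615, .hor 473048 3000 163024 3903, .hor 475845 3934 159445 5825,
    .hor 479492 5429 153946 8578, .hor 484555 6617 146966 11056, .hor 490725 7019 139622 12179,
    .hor 497304 8500 130100 15127, .hor 505282 9025 120244 16345,
    .hor 513703 10685 108078 19594, .hor 523702 10975 96049 20302,
    .hor 533993 12645 81526 23538, .hor 545872 14060 65474 26291, .hor 559082 14885 48713 27923,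
    .hor 573033 16819 29354 31622, .hor 588834 16380 11421 30844, .hor 604197 13826 0 42834,
    .ver 0 3115 612502 12145, .south 604570 24576],
   [.north 42598 21955, .ver 637730 17630 54710 25591, .hor 74085 21320 605814 40639,
    .hor 94058 21884 581081 41798, .hor 114597 19498 560193 37334,
    .hor 132921 17452 541375 33511, .hor 149284 17670 521310 34041,
    .hor 165867 17163 502025 33206, .hor 181947 15074 485751 29310,
    .hor 196108 14773 468888 28891, .hor 209971 14136 452811 27830,
    .hor 223200 13090 438069 25947, .hor 235469 10426 427086 20762,
    .hor 245240 9460 416542 18776, .hor 254122 7432 409087 14386, .ver 405273 7110 258912 10665,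
    .ver 400993 4747 264279 10820, .hor 271967 6853 396081 7271, .hor 278311 7848 395381 5804,
    .ver 398500 6976 283133 5745, .ver 405004 9536 277102 11211, .ver 413877 10078 270742 12666,
    .ver 423304 10921 263448 14034, .ver 433472 11818 255444 15350,
    .ver 444540 11134 248314 14544, .ver 454927 12073 239985 15822,
    .ver 466254 12911 231057 16956, .ver 478313 12048 223312 15843,
    .ver 489616 12788 214468 16830, .ver 501553 13530 205161 17814,
    .ver 514231 14060 195531 18518, .ver 527440 14483 185625 19081,
    .ver 540966 16825 173537 22169, .ver 556727 16399 162661 21608,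
    .ver 572062 17995 150031 23713, .ver 588887 18528 137414 24415,
    .ver 606244 20125 123331 26520, .ver 625092 20658 109263 27221,
    .ver 644473 10887 99719 25369, .north 86835 31130],
   [.north 376832 32768, .ver 584883 70477 351207 55100, .ver 532543 56599 346519 43565,
    .ver 493809 42228 345361 31364, .ver 462172 34239 345902 22705,
    .ver 445756 18509 350679 16681, .hor 360912 17018 436825 14993,
    .hor 376754 13054 438097 9904, .ver 443855 3452 386610 12323,
    .ver 446976 13059 392298 16398, .ver 459100 19609 398423 21191,
    .ver 477524 23021 406265 24610, .ver 499122 29664 414402 31718,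
    .ver 526889 35808 425585 38355, .ver 560446 44076 438910 47295,
    .ver 601799 53561 455622 57651, .north 478413 32768],
   [.hor 426241 14901 285842 18416, .hor 440157 16238 275007 20826,
    .hor 455327 14336 265745 19194, .hor 468730 12138 257334 17075,
    .hor 480070 11087 248317 16664, .hor 490501 7753 241655 13081,
    .ver 234719 9985 494746 12917, .ver 225512 9914 500416 8488, .hor 488061 15982 219273 11470,
    .hor 464991 24105 217437 21074, .hor 446617 19852 224788 20452,
    .hor 431837 15947 233904 19129, .hor 416827 15974 242777 22734,
    .hor 404238 13543 255656 22208, .hor 392100 12929 268279 24246,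
    .hor 383868 9054 283442 18752, .ver 297939 9754 374623 12715,
    .ver 307040 10135 368664 12363, .ver 316492 7427 365971 8351, .ver 323447 4788 364857 5006,
    .ver 327872 2075 364597 2884, .ver 329701 1308 364962 1154, .ver 330907 405 365232 384,
    .hor 365466 514 331027 567, .hor 365911 1520 330314 1443, .hor 367311 3498 328285 3584,
    .hor 370570 6208 324768 6535, .hor 376304 9334 319571 10081, .hor 385051 11433 313378 12715,
    .hor 395789 14365 304989 16497, .hor 409243 14694 296785 17440,
    .hor 423042 7401 286079 26760],
   [.hor 306588 809 284466 9293, .hor 307342 680 289425 8808, .hor 307957 866 294372 6779,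
    .hor 308756 3310 298490 6055, .hor 311744 1274 300061 4393, .ver 297763 3656 311791 2378,
    .ver 294283 3739 311128 2916, .ver 290848 3690 310292 3122, .ver 287950 3151 309627 2787,
    .hor 309796 851 284619 4408, .hor 308971 904 282136 4381, .hor 308188 866 279989 3959,
    .hor 307359 917 277786 3930, .hor 306663 790 276242 3108, .hor 305947 767 274932 2479,
    .hor 305505 524 274668 1282, .hor 305447 78 274873 939, .ver 275464 781 305198 489,
    .ver 276115 1176 305082 777, .ver 277162 1564 305025 1089, .hor 305631 271 277893 3751,
    .hor 305871 481 279548 6034, .hor 306319 818 282387 9616],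
   [.hor 326400 7919 315891 6397, .ver 312239 6456 331969 5053, .hor 330907 3319 309462 4188,
    .hor 324926 6231 308142 4262, .ver 310138 5876 318935 8143, .ver 315536 3638 319429 8408,
    .hor 325760 5515 314607 9717],
   [.hor 301055 3063 313069 2465, .ver 312542 2018 303284 2524, .ver 310465 2264 302397 3479,
    .hor 300088 3197 309409 2474, .ver 310806 2268 298763 2194, .hor 299789 1586 312468 2157],
   [.hor 307281 1339 327477 10636, .ver 335607 5125 304756 4176, .ver 340345 3769 304992 2771,
    .hor 306472 5562 342244 4212, .hor 311667 3483 338409 7274, .ver 331840 8315 312562 6001,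
    .ver 324302 8061 313056 5482, .hor 309202 6431 319764 8487, .hor 308270 1095 323806 9311],
   [.hor 341761 3962 337645 3643, .ver 336904 2013 343896 8417, .ver 333720 3355 345767 7932,
    .hor 342253 5865 330929 4689, .hor 338622 4021 331496 4805, .ver 334784 4435 335019 5175,
    .ver 338862 2054 335036 2093, .ver 340670 884 335259 749, .ver 341500 157 335446 327,
    .hor 335674 715 341367 514, .hor 336261 1528 340779 1288, .hor 337663 2901 339586 2556,
    .hor 340314 4040 338074 3669],
   [.hor 358451 2252 333134 2329, .ver 334677 2460 355428 4491, .hor 357707 2544 336227 2050,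
    .hor 360040 2078 335987 2150, .ver 335152 1565 361539 2065, .ver 333837 1429 362643 1508,
    .ver 333105 854 363420 745, .ver 332824 351 363670 345, .hor 363204 595 332501 669,
    .hor 361967 1332 332447 1256, .hor 360252 1836 332705 1844],
   [.ver 359300 7292 323703 6842, .ver 353032 6761 326153 6556, .ver 348392 5129 328953 5078,
    .ver 345224 3533 330580 4935, .ver 343267 2200 332991 2171, .ver 342501 1012 334108 882,
    .ver 342338 232 334404 399, .hor 333915 628 342013 688, .hor 331997 2046 341750 1680,
    .hor 325866 6257 340908 5198, .hor 319193 7055 340613 9034, .ver 345910 4391 314596 6395,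
    .ver 349929 10008 310390 8652, .ver 359307 11388 306215 10772,
    .ver 369968 10117 302554 10411, .ver 379361 8469 301316 7118, .hor 304095 2596 386577 3069,
    .hor 306432 6026 386112 4613, .hor 312091 5082 383371 6214, .ver 379386 5778 315151 7711,
    .ver 372600 7250 318710 7374, .ver 365628 7466 321495 6951],
   [.ver 407245 19478 376876 20374, .ver 425541 11635 387352 13264,
    .ver 436420 5470 394803 9621, .hor 402144 9949 438687 8031, .hor 411440 18591 434109 15262,
    .ver 427035 13324 425066 14185, .ver 413139 14942 426708 13027,
    .hor 421683 9944 392492 26585, .hor 405263 17110 372209 32276,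
    .hor 392921 13526 362461 21083, .hor 382319 11483 354302 16446,
    .hor 373827 9217 349068 12006, .hor 367265 7234 347662 6749, .ver 350160 4086 365092 3759,
    .ver 353854 11533 362853 8462, .ver 364621 13483 363635 11927,
    .ver 377233 18461 365691 17830, .ver 394598 17194 368952 24310],
   [.ver 363683 8093 284804 10135, .ver 356301 7940 289787 9079, .ver 351589 5309 294622 4483,
    .hor 294754 2567 350334 2315, .hor 288922 6092 349287 5144, .hor 280810 8482 349927 8893,
    .hor 271831 9556 353099 11694, .hor 264015 8455 358932 11906, .hor 258104 6392 365833 10798,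
    .ver 374095 5685 253078 7141, .ver 379310 8872 250941 6953, .hor 254785 12051 384088 10208,
    .hor 266061 8507 384139 8905, .ver 379719 7374 271838 11660, .hor 280870 7087 367876 15199]]

/-- Checks that the tubes around the given arcs are pairwise disjoint. -/
def pairwiseSeparated (L : List (List Cell)) : Bool :=
  List.rec true (fun l L ih => and (L.all fun m => l.all fun c => m.all fun d =>
    c.trace.separated d.trace) ih) L

/-- Checks that a list of cells is nonempty and that consecutive cells are linked. -/
def isChain (l : List Cell) : Bool := List.rec false (fun c l _ => linked c l) l

set_option maxRecDepth 100000

theorem length_arcCells : arcCells.length = 14 := by decide +kernel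

theorem check_arcCells : (arcCells.all fun l => l.all Cell.check) = true := by decide +kernel

theorem isChain_arcCells : arcCells.all isChain = true := by decide +kernel

theorem isTail_arcCells :
    arcCells.map (fun l => l.any Cell.isTail) =
      List.replicate 4 true ++ List.replicate 10 false := by
  decide +kernel

theorem pairwiseSeparated_arcCells : pairwiseSeparated arcCells = true := by decide +kernel

theorem cover_polyA :
    cover 60 polyA 0 655360 0 655360 (arcCells.flatten.map Cell.trace) = true := by
  decide +kernel

theorem cover_polyN :
    cover 60 polyN 0 327680 0 655360 (arcCells.flatten.filterMap Cell.northBox) = true := by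
  decide +kernel

theorem cover_polyS :
    cover 60 polyS 0 327680 0 655360 (arcCells.flatten.filterMap Cell.southBox) = true := by
  decide +kernel

theorem cover_polyE : cover 60 polyE 0 327680 0 655360 [] = true := by decide +kernel

theorem cover_polyW : cover 60 polyW 0 327680 0 655360 [] = true := by decide +kernel

end Data

section Components

theorem connectedComponentIn_eq_of_disjoint {X ι : Type*} [TopologicalSpace X] [Finite ι]
    {A K : ι → Set X} (hAK : ∀ i, A i ⊆ K i) (hK : ∀ i, IsClosed (K i))
    (hd : Pairwise fun i j => Disjoint (K i) (K j)) (hA : ∀ i, IsPreconnected (A i))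
    {i : ι} {x : X} (hx : x ∈ A i) : connectedComponentIn (⋃ j, A j) x = A i := by
  have hxU : x ∈ ⋃ j, A j := Set.mem_iUnion.2 ⟨i, hx⟩
  refine Set.Subset.antisymm (fun y hy => ?_)
    ((hA i).subset_connectedComponentIn hx (Set.subset_iUnion A i))
  obtain ⟨j, hj⟩ := Set.mem_iUnion.1 (connectedComponentIn_subset _ _ hy)
  by_cases hij : j = i
  · exact hij ▸ hj
  have hcl : IsClosed (⋃ j ∈ {j | j ≠ i}, K j) :=
    (Set.toFinite _).isClosed_biUnion fun j _ => hK j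
  obtain ⟨z, -, hz, hz'⟩ := isPreconnected_closed_iff.1
    (isPreconnected_connectedComponentIn (F := ⋃ j, A j) (x := x)) _ _ (hK i) hcl
    (fun z hz => by
      obtain ⟨k, hk⟩ := Set.mem_iUnion.1 (connectedComponentIn_subset _ _ hz)
      by_cases hki : k = i
      · exact Or.inl (hAK i (hki ▸ hk))
      · exact Or.inr (Set.mem_biUnion hki (hAK k hk)))
    ⟨x, mem_connectedComponentIn hxU, hAK i hx⟩
    ⟨y, hy, Set.mem_biUnion hij (hAK j hj)⟩
  obtain ⟨k, hk, hzk⟩ := Set.mem_iUnion₂.1 hz'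
  exact absurd hzk (Set.disjoint_left.1 (hd (Ne.symm hk)) hz)

theorem isPreconnected_arc_of_isChain {l : List Cell} (h : isChain l = true)
    (hl : ∀ c ∈ l, c.check = true) : IsPreconnected (arc l) := by
  cases l with
  | nil => exact absurd h (by decide)
  | cons c l => exact isPreconnected_arc h hl

theorem nonempty_arc_of_isChain {l : List Cell} (h : isChain l = true)
    (hl : ∀ c ∈ l, c.check = true) : (arc l).Nonempty := by
  cases l with
  | nil => exact absurd h (by decide)
  | cons c l =>
    obtain ⟨p, hp, hp'⟩ := Cell.nonempty_arc (hl c List.mem_cons_self)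
    exact ⟨p, hp, c, List.mem_cons_self, hp'⟩

theorem pairwise_of_pairwiseSeparated {L : List (List Cell)} (h : pairwiseSeparated L = true) :
    L.Pairwise fun l m => Disjoint (tube l) (tube m) := by
  induction L with
  | nil => exact List.Pairwise.nil
  | cons l L ih =>
    change (_ && pairwiseSeparated L) = true at h
    simp only [Bool.and_eq_true, List.all_eq_true] at h
    exact List.pairwise_cons.2 ⟨fun m hm => disjoint_tube fun c hc d hd => h.1 m hm c hc d hd,
      ih h.2⟩

/-- The cells of the `i`-th component. -/
def cells (i : Fin 14) : List Cell := arcCells.get (i.cast length_arcCells.symm)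

theorem cells_mem (i : Fin 14) : cells i ∈ arcCells := List.get_mem _ _

theorem check_cells (i : Fin 14) : ∀ c ∈ cells i, c.check = true := by
  have h := check_arcCells
  simp only [List.all_eq_true] at h
  exact h _ (cells_mem i)

theorem isChain_cells (i : Fin 14) : isChain (cells i) = true :=
  List.all_eq_true.1 isChain_arcCells _ (cells_mem i)

theorem disjoint_tube_cells : Pairwise fun i j => Disjoint (tube (cells i)) (tube (cells j)) := by
  have h := List.pairwise_iff_get.1 (pairwise_of_pairwiseSeparated pairwiseSeparated_arcCells)
  intro i j hij
  rcases lt_or_gt_of_ne hij with hlt | hlt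
  · exact h _ _ hlt
  · exact (h _ _ hlt).symm

theorem any_isTail_cells (i : Fin 14) : (cells i).any Cell.isTail = decide (i < 4) := by
  have h : (arcCells.map fun l => l.any Cell.isTail)[i]? = some ((cells i).any Cell.isTail) := by
    have hi : (i : ℕ) < arcCells.length := by rw [length_arcCells]; exact i.2
    simp [cells, List.getElem?_eq_getElem hi]
  rw [isTail_arcCells] at h
  refine Option.some.inj (h.symm.trans ?_)
  clear h
  revert i
  decide

theorem isBounded_arc_cells_iff (i : Fin 14) : Bornology.IsBounded (arc (cells i)) ↔ 4 ≤ i := by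
  have h := any_isTail_cells i
  constructor
  · intro hb
    by_contra hi
    rw [decide_eq_true (not_le.1 hi), List.any_eq_true] at h
    obtain ⟨c, hc, ht⟩ := h
    exact not_isBounded_arc hc (check_cells i c hc) ht hb
  · intro hi
    rw [decide_eq_false (not_lt.2 hi), List.any_eq_false] at h
    exact isBounded_arc fun c hc => by simpa using h c hc

theorem curve_eq_iUnion : curve = ⋃ i, arc (cells i) := by
  ext p
  simp only [Set.mem_iUnion]
  constructor
  · intro hp
    obtain ⟨c, hc, hpc⟩ :=
      exists_mem_region cover_polyA cover_polyN cover_polyS cover_polyE cover_polyW hp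
    obtain ⟨l, hl, hcl⟩ := List.mem_flatten.1 hc
    obtain ⟨i, rfl⟩ := List.mem_iff_get.1 hl
    exact ⟨i.cast length_arcCells, hp, c, hcl, hpc⟩
  · rintro ⟨i, hp, -⟩
    exact hp

theorem injective_arc_cells : Function.Injective fun i => arc (cells i) := by
  intro i j (h : arc (cells i) = arc (cells j))
  by_contra hij
  obtain ⟨p, hp⟩ := nonempty_arc_of_isChain (isChain_cells i) (check_cells i)
  exact Set.disjoint_left.1 (disjoint_tube_cells hij) (arc_subset_tube (check_cells i) hp)
    (arc_subset_tube (check_cells j) (h ▸ hp))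

theorem components_curve : components curve = Set.range fun i => arc (cells i) := by
  have key {i : Fin 14} {p : ℝ × ℝ} (hp : p ∈ arc (cells i)) :
      connectedComponentIn curve p = arc (cells i) := by
    rw [curve_eq_iUnion]
    exact connectedComponentIn_eq_of_disjoint (A := fun i => arc (cells i))
      (fun i => arc_subset_tube (check_cells i)) (fun i => isClosed_tube _) disjoint_tube_cells
      (fun i => isPreconnected_arc_of_isChain (isChain_cells i) (check_cells i)) hp
  ext C
  constructor
  · rintro ⟨p, hp, rfl⟩
    rw [curve_eq_iUnion] at hp
    obtain ⟨i, hi⟩ := Set.mem_iUnion.1 hp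
    exact ⟨i, (key hi).symm⟩
  · rintro ⟨i, rfl⟩
    obtain ⟨p, hp⟩ := nonempty_arc_of_isChain (isChain_cells i) (check_cells i)
    exact ⟨p, hp.1, (key hp).symm⟩

theorem ncard_components_curve (P : Set (ℝ × ℝ) → Prop) (s : Finset (Fin 14))
    (h : ∀ i, P (arc (cells i)) ↔ i ∈ s) : {C ∈ components curve | P C}.ncard = s.card := by
  have e : {C ∈ components curve | P C} = (fun i => arc (cells i)) '' s := by
    ext C
    rw [components_curve]
    constructor
    · rintro ⟨⟨i, rfl⟩, hP⟩
      exact ⟨i, (h i).1 hP, rfl⟩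
    · rintro ⟨i, hi, rfl⟩
      exact ⟨⟨i, rfl⟩, (h i).2 hi⟩
  rw [e, Set.ncard_image_of_injective _ injective_arc_cells, Set.ncard_coe_finset]

end Components

section Hessian

theorem pderiv_ofNat (i : Fin 2) (n : ℕ) [n.AtLeastTwo] :
    pderiv (R := ℝ) i (no_index (OfNat.ofNat n)) = 0 := by
  rw [← map_ofNat C n]
  exact pderiv_C

theorem eval_pderiv_zero_zero (x y : ℝ) :
    eval ![x, y] (pderiv 0 (pderiv 0 f)) = formXX x y 1 := by
  have h10 : pderiv (R := ℝ) (0 : Fin 2) (X 1) = 0 := pderiv_X_of_ne (by decide)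
  have h00 : pderiv (R := ℝ) (0 : Fin 2) (X 0) = 1 := pderiv_X_self _
  simp [f, pderiv_ofNat, h10, h00, formXX]
  ring

theorem eval_pderiv_zero_one (x y : ℝ) :
    eval ![x, y] (pderiv 0 (pderiv 1 f)) = formXY x y 1 := by
  have h10 : pderiv (R := ℝ) (0 : Fin 2) (X 1) = 0 := pderiv_X_of_ne (by decide)
  have h00 : pderiv (R := ℝ) (0 : Fin 2) (X 0) = 1 := pderiv_X_self _
  have h01 : pderiv (R := ℝ) (1 : Fin 2) (X 0) = 0 := pderiv_X_of_ne (by decide)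
  have h11 : pderiv (R := ℝ) (1 : Fin 2) (X 1) = 1 := pderiv_X_self _
  simp [f, pderiv_ofNat, h10, h00, h01, h11, formXY]
  ring

theorem eval_pderiv_one_one (x y : ℝ) :
    eval ![x, y] (pderiv 1 (pderiv 1 f)) = formYY x y 1 := by
  have h01 : pderiv (R := ℝ) (1 : Fin 2) (X 0) = 0 := pderiv_X_of_ne (by decide)
  have h11 : pderiv (R := ℝ) (1 : Fin 2) (X 1) = 1 := pderiv_X_self _
  simp [f, pderiv_ofNat, h01, h11, formYY]
  ring

theorem Z_eq_curve : Z = curve := by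
  ext p
  change eval ![p.1, p.2] (Hess f) = 0 ↔ form p.1 p.2 1 = 0
  simp [Hess, eval_pderiv_zero_zero, eval_pderiv_zero_one, eval_pderiv_one_one, form]

end Hessian

end HessCurve

/-- The hessian curve of `f` has exactly 14 connected components: 10 bounded (ovals)
and 4 unbounded. -/
theorem hessian_curve_components :
    (components Z).ncard = 14 ∧
    {C ∈ components Z | Bornology.IsBounded C}.ncard = 10 ∧
    {C ∈ components Z | ¬ Bornology.IsBounded C}.ncard = 4 := by
  rw [HessCurve.Z_eq_curve]
  refine ⟨?_, ?_, ?_⟩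
  · simpa using HessCurve.ncard_components_curve (fun _ => True) Finset.univ (by simp)
  · rw [HessCurve.ncard_components_curve _ {i | 4 ≤ i}
      fun i => by simp [HessCurve.isBounded_arc_cells_iff]]
    decide
  · rw [HessCurve.ncard_components_curve _ {i | i < 4}
      fun i => by simp [HessCurve.isBounded_arc_cells_iff]]
    decide
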